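/- arXiv:1202.4976 — 5 statements merged into one kernel-verified Lean document; each statement's English description precedes it below -/
import Mathlib

section
/- Let n ≥ 2 and let G_n be the Cayley graph of 𝔖_n generated by the transpositions (1 i) for 2 ≤ i ≤ n. Then every eigenvalue of the adjacency matrix of G_n is an integer. -/
open Equiv Polynomial

/-- Adjacency matrix of the Cayley graph `G_n` of `𝔖_n = Perm (Fin n)` generated by the
transpositions `(1 i)` for `2 ≤ i ≤ n` (here `0 : Fin n` plays the role of the element `1`,
and the generators are `swap 0 i` for `i ≠ 0`). -/
noncomputable def adjMatn : (n : ℕ) → Matrix (Equiv.Perm (Fin n)) (Equiv.Perm (Fin n)) ℂ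
  | 0 => 0
  | m + 1 => fun σ τ =>
      if ∃ i : Fin (m + 1), i ≠ 0 ∧ τ * σ⁻¹ = Equiv.swap 0 i then 1 else 0

/-- If `A` and `B` commute, `S` is an involution and `A * S = S * B - 1` (the relations of the
degenerate affine Hecke algebra), then integrality of the eigenvalues passes from `A` to `B`. -/
theorem Module.End.eigenvalue_integral_of_hecke_relation {V : Type*} [AddCommGroup V] [Module ℂ V]
    [FiniteDimensional ℂ V] {A B S : Module.End ℂ V} (hAB : Commute A B) (hS : S * S = 1)
    (hASB : A * S = S * B - 1) (hA : ∀ μ, A.HasEigenvalue μ → ∃ k : ℤ, μ = k)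
    {b : ℂ} (hb : B.HasEigenvalue b) : ∃ k : ℤ, b = k := by
  have hmaps : Set.MapsTo A (B.eigenspace b) (B.eigenspace b) :=
    Module.End.mapsTo_genEigenspace_of_comm hAB.symm b 1
  have : Nontrivial (B.eigenspace b) := Submodule.nontrivial_iff_ne_bot.2 hb
  obtain ⟨a, ha⟩ := Module.End.exists_eigenvalue (A.restrict hmaps)
  obtain ⟨⟨v, hvB⟩, hv⟩ := ha.exists_hasEigenvector
  have hv0 : v ≠ 0 := fun h => hv.2 (Subtype.ext h)
  have hAv : A v = a • v := congrArg Subtype.val hv.apply_eq_smul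
  have hBv : B v = b • v := Module.End.mem_eigenspace_iff.1 hvB
  obtain ⟨k, rfl⟩ := hA a
    (Module.End.hasEigenvalue_of_hasEigenvector ⟨Module.End.mem_eigenspace_iff.2 hAv, hv0⟩)
  by_cases hkb : (k : ℂ) = b
  · exact ⟨k, hkb.symm⟩
  have hkb' : (k : ℂ) - b ≠ 0 := sub_ne_zero.2 hkb
  have hASv : A (S v) = b • S v - v := by
    simpa [hBv] using LinearMap.congr_fun hASB v
  have hSSv : S (S v) = v := by simpa using LinearMap.congr_fun hS v
  by_cases hu : ((k : ℂ) - b) • S v + v = 0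
  · have hSu : ((k : ℂ) - b) • v + S v = 0 := by
      simpa [hSSv] using congrArg S hu
    have hsq : (((k : ℂ) - b) * ((k : ℂ) - b) - 1) • v = 0 := by
      calc
        _ = ((k : ℂ) - b) • (((k : ℂ) - b) • v + S v) - (((k : ℂ) - b) • S v + v) := by module
        _ = 0 := by rw [hSu, hu, smul_zero, sub_zero]
    have h1 := (smul_eq_zero.1 hsq).resolve_right hv0
    rcases mul_self_eq_one_iff.1 (sub_eq_zero.1 h1) with h | h
    · exact ⟨k - 1, by push_cast; linear_combination -h⟩
    · exact ⟨k + 1, by push_cast; linear_combination -h⟩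
  · refine hA b (Module.End.hasEigenvalue_of_hasEigenvector
      ⟨Module.End.mem_eigenspace_iff.2 ?_, hu⟩)
    rw [map_add, map_smul, hASv, hAv]
    module

/-- Jucys–Murphy elements act with integral eigenvalues in every finite-dimensional complex
representation of a symmetric group. -/
theorem Equiv.Perm.jucysMurphy_eigenvalue_integral {α V : Type*} [DecidableEq α] [AddCommGroup V]
    [Module ℂ V] [FiniteDimensional ℂ V] (ρ : Equiv.Perm α →* Module.End ℂ V) (T : Finset α) :
    ∀ p ∉ T, ∀ μ, (∑ i ∈ T, ρ (swap p i)).HasEigenvalue μ → ∃ k : ℤ, μ = k := by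
  induction T using Finset.induction_on with
  | empty =>
    intro p _ μ hμ
    obtain ⟨v, hv⟩ := hμ.exists_hasEigenvector
    have h := hv.apply_eq_smul
    rw [Finset.sum_empty, LinearMap.zero_apply, eq_comm, smul_eq_zero] at h
    exact ⟨0, by simpa using h.resolve_right hv.2⟩
  | insert q T hqT ih =>
    intro p hp μ hμ
    have hpq : p ≠ q := fun h => hp (h ▸ Finset.mem_insert_self _ _)
    have hpT : p ∉ T := fun h => hp (Finset.mem_insert_of_mem h)
    have hS : ρ (swap p q) * ρ (swap p q) = 1 := by rw [← map_mul, swap_mul_self, map_one]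
    refine Module.End.eigenvalue_integral_of_hecke_relation (A := ∑ i ∈ T, ρ (swap q i))
      (S := ρ (swap p q)) ?_ hS ?_ (ih q hqT) hμ
    · refine Commute.sum_left _ _ _ fun i hi => ?_
      have hpi : p ≠ i := fun h => hpT (h ▸ hi)
      rw [Commute, SemiconjBy, Finset.mul_sum, Finset.sum_mul]
      refine Finset.sum_equiv (swap q i) (fun j => ?_) fun j _ => ?_
      · by_cases hjq : j = q
        · simp [hjq, hi]
        by_cases hji : j = i
        · simp [hji, hi]
        rw [swap_apply_of_ne_of_ne hjq hji]
      · rw [← map_mul, ← map_mul, mul_swap_eq_swap_mul, swap_apply_of_ne_of_ne hpq hpi]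
    · rw [Finset.sum_insert hqT, mul_add, hS, add_sub_cancel_left, Finset.sum_mul, Finset.mul_sum]
      refine Finset.sum_congr rfl fun i hi => ?_
      have hqi : q ≠ i := fun h => hqT (h ▸ hi)
      have hpi : p ≠ i := fun h => hpT (h ▸ hi)
      rw [← map_mul, ← map_mul, mul_swap_eq_swap_mul (swap p q), swap_apply_left,
        swap_apply_of_ne_of_ne hpi.symm hqi.symm]

/-- The left regular representation of a group on complex-valued functions. -/
def leftRegularFun (G : Type*) [Group G] : G →* Module.End ℂ (G → ℂ) where
  toFun g := LinearMap.funLeft ℂ ℂ fun x => g⁻¹ * x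
  map_one' := by ext; simp [LinearMap.funLeft]
  map_mul' g h := by ext; simp [LinearMap.funLeft, mul_assoc]

theorem toLin'_adjMatn_succ (m : ℕ) :
    Matrix.toLin' (adjMatn (m + 1)) =
      ∑ i ∈ Finset.univ.erase (0 : Fin (m + 1)), leftRegularFun _ (swap 0 i) := by
  refine LinearMap.ext fun v => funext fun σ => ?_
  have hentry (τ : Equiv.Perm (Fin (m + 1))) : adjMatn (m + 1) σ τ =
      ∑ i ∈ Finset.univ.erase (0 : Fin (m + 1)), if swap 0 i * σ = τ then 1 else 0 := by
    simp only [adjMatn]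
    split_ifs with h
    · obtain ⟨i, hi, h⟩ := h
      rw [Finset.sum_eq_single_of_mem i (by simpa using hi), if_pos (by rw [← h]; group)]
      intro j _ hji
      refine if_neg fun hj => hji ?_
      rw [← hj, mul_inv_cancel_right] at h
      simpa using congrArg (fun π : Equiv.Perm (Fin (m + 1)) => π 0) h
    · refine (Finset.sum_eq_zero fun i hi => if_neg fun hσ => h ?_).symm
      refine ⟨i, Finset.ne_of_mem_erase hi, ?_⟩
      rw [← hσ, mul_inv_cancel_right]
  simp only [Matrix.toLin'_apply, Matrix.mulVec, dotProduct, hentry, Finset.sum_mul]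
  rw [Finset.sum_comm]
  simp [leftRegularFun, LinearMap.funLeft_apply, LinearMap.sum_apply]

/-- Every eigenvalue of the adjacency matrix of `G_n` is an integer. -/
theorem cayley_spectrum_integral (n : ℕ) (hn : 2 ≤ n) :
    ∀ μ ∈ (adjMatn n).charpoly.roots, ∃ k : ℤ, μ = (k : ℂ) := by
  intro μ hμ
  obtain ⟨m, rfl⟩ : ∃ m, n = m + 1 := ⟨n - 1, by omega⟩
  refine Equiv.Perm.jucysMurphy_eigenvalue_integral (leftRegularFun _)
    (Finset.univ.erase (0 : Fin (m + 1))) 0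
    (Finset.notMem_erase _ _) μ ?_
  rw [← toLin'_adjMatn_succ, Module.End.hasEigenvalue_iff_isRoot_charpoly, Matrix.charpoly_toLin']
  exact isRoot_of_mem_roots hμ
end

section
/- Let n ≥ 2 and k ∈ ℤ. The multiplicity mul(k) of k as an eigenvalue of the adjacency matrix of the Cayley graph G_n of 𝔖_n generated by (1 i), 2 ≤ i ≤ n, equals the number of ordered pairs (T, T') of standard Young tableaux with n boxes having the same shape λ ⊢ n such that in T the entry n occupies a box of content k. Equivalently, mul(k) = Σ_{λ ⊢ n} f_λ · I_λ(k), where f_λ is the number of standard Young tableaux of shape λ and I_λ(k) is the number of standard Young tableaux of shape λ in which n lies in a box of content k. -/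
open Equiv Polynomial

/-- A standard Young tableau of shape `μ`: a filling of the cells of `μ` with the
numbers `1, …, μ.card`, each used exactly once, strictly increasing along rows and
columns; entries outside the diagram are `0`. -/
structure SYT (μ : YoungDiagram) where
  entry : ℕ × ℕ → ℕ
  zeros' : ∀ c, c ∉ μ.cells → entry c = 0
  bijOn' : Set.BijOn entry (μ.cells : Set (ℕ × ℕ)) (Set.Icc 1 μ.card)
  row_strict : ∀ i j1 j2, j1 < j2 → (i, j2) ∈ μ → entry (i, j1) < entry (i, j2)
  col_strict : ∀ i1 i2 j, i1 < i2 → (i2, j) ∈ μ → entry (i1, j) < entry (i2, j)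

/-- The content of a cell of a Young diagram (in the coordinates of the paper, where the
cells of the first column have contents `0, 1, 2, …` and those of the first row have
contents `0, −1, −2, …`). -/
def cellContent (c : ℕ × ℕ) : ℤ := (c.1 : ℤ) - (c.2 : ℤ)

namespace StarCayley

/-- A standard filling, given by the sequence of cells in decreasing order of their entries:
`p 0` is the cell of the largest entry. -/
structure IsStd {n : ℕ} (p : Fin n → ℕ × ℕ) : Prop where
  lower : IsLowerSet (Set.range p)
  anti : ∀ i j, p i ≤ p j → j ≤ i

theorem IsStd.injective {n : ℕ} {p : Fin n → ℕ × ℕ} (hp : IsStd p) : Function.Injective p :=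
  fun i j h => le_antisymm (hp.anti j i h.ge) (hp.anti i j h.le)

theorem IsStd.swap {n : ℕ} {p : Fin n → ℕ × ℕ} (hp : IsStd p) {i j : Fin n}
    (hij : i.val + 1 = j.val) (h : ¬ p j ≤ p i) : IsStd (p ∘ Equiv.swap i j) := by
  refine ⟨by rw [(Equiv.swap i j).surjective.range_comp]; exact hp.lower, fun a b hab => ?_⟩
  have h1 := hp.anti _ _ hab
  by_contra hlt
  have h2 : a = i ∧ b = j := by
    rw [Equiv.swap_apply_def, Equiv.swap_apply_def] at h1
    clear hab h
    simp only [Fin.ext_iff, Fin.le_def, not_le] at *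
    split_ifs at h1 <;> omega
  obtain ⟨rfl, rfl⟩ := h2
  simp only [Function.comp_apply, Equiv.swap_apply_left, Equiv.swap_apply_right] at hab
  exact h hab

/-- Consecutive comparable cells of a standard filling are adjacent. -/
theorem IsStd.content_of_le {n : ℕ} {p : Fin n → ℕ × ℕ} (hp : IsStd p) {i j : Fin n}
    (hij : i.val + 1 = j.val) (h : p j ≤ p i) :
    cellContent (p i) = cellContent (p j) + 1 ∨ cellContent (p i) = cellContent (p j) - 1 := by
  have key : ∀ x, p j ≤ x → x ≤ p i → x ≠ p i → x = p j := by
    intro x h1 h2 h3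
    obtain ⟨k, rfl⟩ := hp.lower h2 ⟨i, rfl⟩
    have h4 := hp.anti _ _ h1
    have h5 := hp.anti _ _ h2
    have h6 : k ≠ i := fun h => h3 (by rw [h])
    congr 1
    simp only [Fin.le_def, Fin.ext_iff, ne_eq] at *
    omega
  have hne : p j ≠ p i := fun h => by
    have := hp.injective h
    simp [this] at hij
  obtain ⟨h1, h2⟩ := Prod.le_def.1 h
  unfold cellContent
  rcases h1.lt_or_eq with h3 | h3
  · have := key ((p i).1 - 1, (p i).2) (Prod.le_def.2 ⟨by simp; omega, by simpa using h2⟩)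
      (Prod.le_def.2 ⟨by simp, by simp⟩) (fun h => by
        have := congrArg Prod.fst h; simp at this; omega)
    have e1 := congrArg Prod.fst this
    have e2 := congrArg Prod.snd this
    simp only at e1 e2
    left; omega
  · have h4 : (p j).2 < (p i).2 := lt_of_le_of_ne h2 fun h => hne (Prod.ext h3 h)
    have := key ((p i).1, (p i).2 - 1) (Prod.le_def.2 ⟨by simpa using h1, by simp; omega⟩)
      (Prod.le_def.2 ⟨by simp, by simp⟩) (fun h => by
        have := congrArg Prod.snd h; simp at this; omega)
    have e1 := congrArg Prod.fst this
    have e2 := congrArg Prod.snd this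
    simp only at e1 e2
    right; omega

theorem content_of_not_le {x y : ℕ × ℕ} (h1 : ¬ x ≤ y) (h2 : ¬ y ≤ x) :
    cellContent x ≠ cellContent y ∧ cellContent x ≠ cellContent y + 1 ∧
      cellContent x ≠ cellContent y - 1 := by
  rw [Prod.le_def] at h1 h2
  unfold cellContent
  omega

/-- Cells on one diagonal are comparable. -/
theorem le_total_of_content_eq {x y : ℕ × ℕ} (h : cellContent x = cellContent y) :
    x ≤ y ∨ y ≤ x := by
  simp only [Prod.le_def]
  unfold cellContent at h
  omega

theorem IsStd.content_ne {n : ℕ} {p : Fin n → ℕ × ℕ} (hp : IsStd p) {i j : Fin n}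
    (hij : i.val + 1 = j.val) : cellContent (p i) ≠ cellContent (p j) := by
  intro h
  by_cases hle : p j ≤ p i
  · rcases hp.content_of_le hij hle with h' | h' <;> omega
  · rcases le_total_of_content_eq h with h' | h'
    · have := hp.anti _ _ h'
      rw [Fin.le_def] at this
      omega
    · exact hle h'

/-- Fillings are determined by their content vectors. -/
theorem IsStd.eq_of_content {n : ℕ} {p q : Fin n → ℕ × ℕ} (hp : IsStd p) (hq : IsStd q)
    (h : ∀ i, cellContent (p i) = cellContent (q i)) : p = q := by
  have key : ∀ {p q : Fin n → ℕ × ℕ}, IsStd p → IsStd q → ∀ i, (∀ k, i < k → p k = q k) →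
      p i ≤ q i → p i = q i := by
    intro p q hp hq i ih hle
    obtain ⟨k, hk⟩ := hq.lower hle ⟨i, rfl⟩
    have h1 := hq.anti k i (hk.trans_le hle)
    rcases h1.lt_or_eq with h2 | h2
    · rw [← ih k h2] at hk
      exact absurd (hp.injective hk) h2.ne'
    · rw [← hk, h2]
  funext i
  induction i using WellFoundedGT.induction with
  | ind i ih =>
    rcases le_total_of_content_eq (h i) with h1 | h1
    · exact key hp hq i ih h1
    · exact (key hq hp i (fun k hk => (ih k hk).symm) h1).symm

/-- Any two fillings of one shape are connected by admissible transpositions. -/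
theorem IsStd.connected {n : ℕ} (Q : (Fin n → ℕ × ℕ) → Prop)
    (hQ : ∀ p, IsStd p → Q p → ∀ i j : Fin n, i.val + 1 = j.val →
      cellContent (p i) ≠ cellContent (p j) + 1 → cellContent (p i) ≠ cellContent (p j) - 1 →
      Q (p ∘ Equiv.swap i j))
    {p q : Fin n → ℕ × ℕ} (hp : IsStd p) (hq : IsStd q) (hpq : Set.range p = Set.range q)
    (h : Q q) : Q p := by
  have key : ∀ d m, m + d = n → ∀ q, IsStd q → Set.range p = Set.range q → Q q →
      (∀ i : Fin n, i.val < m → p i = q i) → Q p := by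
    intro d
    induction d with
    | zero =>
      intro m hm q hq hpq h hag
      rwa [show p = q from funext fun i => hag i (by omega)]
    | succ d ih =>
      intro m hm q hq hpq h hag
      have hmn : m < n := by omega
      have bubble : ∀ e (j : Fin n), j.val = m + e → ∀ q, IsStd q → Set.range p = Set.range q →
          Q q → (∀ i : Fin n, i.val < m → p i = q i) → q j = p ⟨m, hmn⟩ → Q p := by
        intro e
        induction e with
        | zero =>
          intro j hj q hq hpq h hag hx
          refine ih (m + 1) (by omega) q hq hpq h fun i hi => ?_
          rcases Nat.lt_succ_iff_lt_or_eq.1 hi with h1 | h1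
          · exact hag i h1
          · rw [show i = ⟨m, hmn⟩ from Fin.ext h1, ← hx]
            congr 1
            exact Fin.ext hj
        | succ e ihe =>
          intro j hj q hq hpq h hag hx
          have hlt : m + e < n := by have := j.2; omega
          set i : Fin n := ⟨m + e, hlt⟩ with hi
          have hij : i.val + 1 = j.val := by simp [hi]; omega
          have h1 : ¬ q i ≤ q j := fun hle => by
            have := hq.anti _ _ hle
            rw [Fin.le_def] at this; omega
          have h2 : ¬ q j ≤ q i := fun hle => by
            obtain ⟨k, hk⟩ : q i ∈ Set.range p := hpq ▸ ⟨i, rfl⟩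
            rw [hx, ← hk] at hle
            have h3 := hp.anti _ _ hle
            have h4 : ¬ k.val < m := fun hk' => by
              have := hq.injective ((hag k hk').symm.trans hk)
              rw [this] at hk'
              simp [hi] at hk'
            have h5 : k = ⟨m, hmn⟩ := by
              rw [Fin.le_def] at h3
              exact Fin.ext (by simp at h3 ⊢; omega)
            rw [h5, ← hx] at hk
            have := hq.injective hk
            rw [this] at hij; omega
          obtain ⟨-, c2, c3⟩ := content_of_not_le h1 h2
          refine ihe i rfl (q ∘ Equiv.swap i j) (hq.swap hij h2)
            (by rw [(Equiv.swap i j).surjective.range_comp]; exact hpq) (hQ q hq h i j hij c2 c3) ?_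
            (by simpa using hx)
          intro k hk
          rw [Function.comp_apply, Equiv.swap_apply_of_ne_of_ne]
          · exact hag k hk
          · rintro rfl; simp [hi] at hk
          · rintro rfl; omega
      obtain ⟨j, hj⟩ : p ⟨m, hmn⟩ ∈ Set.range q := hpq ▸ ⟨_, rfl⟩
      have hjm : m ≤ j.val := by
        by_contra hlt
        push Not at hlt
        have := hp.injective ((hag j hlt).trans hj)
        rw [this] at hlt
        simp at hlt
      exact bubble (j.val - m) j (by omega) q hq hpq h hag hj
  exact key n 0 (by omega) q hq hpq h (fun i hi => by omega)

theorem isStd_cons {n : ℕ} {p : Fin n → ℕ × ℕ} {x : ℕ × ℕ} :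
    IsStd (Fin.cons x p : Fin (n + 1) → ℕ × ℕ) ↔
      IsStd p ∧ x ∉ Set.range p ∧ IsLowerSet (insert x (Set.range p)) := by
  constructor
  · intro h
    have hx : x ∉ Set.range p := by
      rintro ⟨k, hk⟩
      have := h.anti k.succ 0 (by simp [hk])
      have := h.anti 0 k.succ (by simp [hk])
      simp at this
    refine ⟨⟨?_, fun i j hij => ?_⟩, hx, by simpa [Fin.range_cons] using h.lower⟩
    · rintro a b hba ⟨k, rfl⟩
      obtain ⟨l, rfl⟩ := h.lower hba ⟨k.succ, by simp⟩
      have := h.anti l k.succ (by simpa using hba)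
      obtain rfl | ⟨l, rfl⟩ := l.eq_zero_or_eq_succ
      · simp at this
      · exact ⟨l, by simp⟩
    · simpa using h.anti i.succ j.succ (by simpa using hij)
  · rintro ⟨hp, hx, hl⟩
    refine ⟨by simpa [Fin.range_cons] using hl, fun i j hij => ?_⟩
    obtain rfl | ⟨j, rfl⟩ := j.eq_zero_or_eq_succ
    · simp
    · obtain rfl | ⟨i, rfl⟩ := i.eq_zero_or_eq_succ
      · exact absurd (hp.lower (by simpa using hij) ⟨j, rfl⟩) hx
      · simpa using hp.anti i j (by simpa using hij)

/-- A vector of integers in which every nonzero entry has a later neighbour and any two equal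
entries are separated by both their neighbours is a content vector. -/
theorem exists_isStd_of_int {n : ℕ} (α : Fin n → ℤ)
    (hn : ∀ i, α i ≠ 0 → ∃ k, i < k ∧ (α k = α i + 1 ∨ α k = α i - 1))
    (hb : ∀ i j, i < j → α i = α j →
      (∃ k, i < k ∧ k < j ∧ α k = α i + 1) ∧ (∃ k, i < k ∧ k < j ∧ α k = α i - 1)) :
    ∃ p, IsStd p ∧ ∀ i, cellContent (p i) = α i := by
  induction n with
  | zero =>
    exact ⟨Fin.elim0, ⟨fun a b _ ⟨k, _⟩ => k.elim0, fun i => i.elim0⟩, fun i => i.elim0⟩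
  | succ n ih =>
    obtain ⟨p, hp, hpα⟩ := ih (fun i => α i.succ)
      (fun i hi => by
        obtain ⟨k, hk, h⟩ := hn i.succ hi
        obtain rfl | ⟨k, rfl⟩ := k.eq_zero_or_eq_succ
        · simp at hk
        · exact ⟨k, by simpa using hk, h⟩)
      (fun i j hij h => by
        obtain ⟨⟨k, h1, h2, h3⟩, ⟨l, h4, h5, h6⟩⟩ := hb i.succ j.succ (by simpa using hij) h
        obtain rfl | ⟨k, rfl⟩ := k.eq_zero_or_eq_succ
        · simp at h1
        obtain rfl | ⟨l, rfl⟩ := l.eq_zero_or_eq_succ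
        · simp at h4
        exact ⟨⟨k, by simpa using h1, by simpa using h2, h3⟩,
          ⟨l, by simpa using h4, by simpa using h5, h6⟩⟩)
    suffices ∃ x, cellContent x = α 0 ∧ x ∉ Set.range p ∧ ∀ y, y ≤ x → y ≠ x → y ∈ Set.range p by
      obtain ⟨x, hx, hxp, hl⟩ := this
      refine ⟨Fin.cons x p, isStd_cons.2 ⟨hp, hxp, ?_⟩, fun i => ?_⟩
      · intro a b hba ha
        rcases ha with rfl | ha
        · by_cases h : b = a
          · exact Or.inl h
          · exact Or.inr (hl b hba h)
        · exact Or.inr (hp.lower hba ha)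
      · obtain rfl | ⟨i, rfl⟩ := i.eq_zero_or_eq_succ
        · simpa using hx
        · simpa using hpα i
    by_cases hc : ∃ k, α (Fin.succ k) = α 0
    · obtain ⟨k, hk, hmin⟩ : ∃ k : Fin n, α k.succ = α 0 ∧ ∀ l : Fin n, α l.succ = α 0 → k ≤ l := by
        classical
        have hne : (Finset.univ.filter fun k : Fin n => α k.succ = α 0).Nonempty :=
          ⟨hc.choose, by simpa using hc.choose_spec⟩
        exact ⟨_, (Finset.mem_filter.1 (Finset.min'_mem _ hne)).2,
          fun l hl => Finset.min'_le _ _ (by simpa using hl)⟩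
      obtain ⟨⟨a, h1, h2, h3⟩, ⟨b, h4, h5, h6⟩⟩ := hb 0 k.succ (by simp) hk.symm
      obtain rfl | ⟨a, rfl⟩ := a.eq_zero_or_eq_succ
      · simp at h1
      obtain rfl | ⟨b, rfl⟩ := b.eq_zero_or_eq_succ
      · simp at h4
      have ha : ¬ p a ≤ p k := fun h => by
        have := hp.anti _ _ h
        exact absurd (Fin.succ_lt_succ_iff.1 h2) this.not_gt
      have hb' : ¬ p b ≤ p k := fun h => by
        have := hp.anti _ _ h
        exact absurd (Fin.succ_lt_succ_iff.1 h5) this.not_gt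
      rw [← hpα] at h3 h6
      have hk' := hk
      rw [← hpα] at hk'
      rw [← hk'] at h3 h6
      rw [Prod.le_def] at ha hb'
      refine ⟨((p k).1 + 1, (p k).2 + 1), by rw [← hk']; simp [cellContent], ?_, fun y hy hne => ?_⟩
      · rintro ⟨l, hl⟩
        have h7 := hmin l (by rw [← hpα, ← hk', hl]; simp [cellContent])
        have h8 := hp.anti k l (by rw [hl]; exact Prod.le_def.2 ⟨by simp, by simp⟩)
        rw [le_antisymm h8 h7] at hl
        have := congrArg Prod.fst hl
        simp at this
      · rw [Prod.le_def] at hy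
        rw [Ne, Prod.ext_iff] at hne
        simp only at hy hne
        unfold cellContent at h3 h6
        by_cases h : y.2 ≤ (p k).2
        · exact hp.lower (Prod.le_def.2 ⟨by omega, by omega⟩) ⟨a, rfl⟩
        · exact hp.lower (Prod.le_def.2 ⟨by omega, by omega⟩) ⟨b, rfl⟩
    · push Not at hc
      have hc' : ∀ x ∈ Set.range p, cellContent x ≠ α 0 := by
        rintro _ ⟨k, rfl⟩
        rw [hpα]; exact hc k
      rcases lt_trichotomy (α 0) 0 with h | h | h
      · obtain ⟨k, hk, hk'⟩ := hn 0 h.ne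
        obtain rfl | ⟨k, rfl⟩ := k.eq_zero_or_eq_succ
        · simp at hk
        rw [← hpα] at hk'
        refine ⟨(0, (-α 0).toNat), by simp [cellContent]; omega, fun hm =>
          hc' _ hm (by simp [cellContent]; omega), fun y hy hne => ?_⟩
        rw [Prod.le_def] at hy
        rw [Ne, Prod.ext_iff] at hne
        simp only at hy hne
        unfold cellContent at hk'
        rcases hk' with h1 | h1
        · exact hp.lower (Prod.le_def.2 ⟨by omega, by omega⟩) ⟨k, rfl⟩
        · refine absurd ?_ (hc' ((p k).1, (p k).2 - 1)
            (hp.lower (Prod.le_def.2 ⟨by simp, by simp⟩) ⟨k, rfl⟩))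
          simp only [cellContent]
          omega
      · refine ⟨(0, 0), by simp [cellContent, h], fun hm => hc' _ hm (by simp [cellContent, h]),
          fun y hy hne => absurd ?_ hne⟩
        rw [Prod.le_def] at hy
        simp only at hy
        exact Prod.ext (by simp; omega) (by simp; omega)
      · obtain ⟨k, hk, hk'⟩ := hn 0 h.ne'
        obtain rfl | ⟨k, rfl⟩ := k.eq_zero_or_eq_succ
        · simp at hk
        rw [← hpα] at hk'
        refine ⟨((α 0).toNat, 0), by simp [cellContent]; omega, fun hm =>
          hc' _ hm (by simp [cellContent]; omega), fun y hy hne => ?_⟩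
        rw [Prod.le_def] at hy
        rw [Ne, Prod.ext_iff] at hne
        simp only at hy hne
        unfold cellContent at hk'
        rcases hk' with h1 | h1
        · refine absurd ?_ (hc' ((p k).1 - 1, (p k).2)
            (hp.lower (Prod.le_def.2 ⟨by simp, by simp⟩) ⟨k, rfl⟩))
          simp only [cellContent]
          omega
        · exact hp.lower (Prod.le_def.2 ⟨by omega, by omega⟩) ⟨k, rfl⟩

/-- The combinatorial constraints on joint eigenvalues of the Jucys-Murphy operators. -/
structure IsWeightSet {n : ℕ} (S : Set (Fin n → ℂ)) : Prop where
  last : ∀ α ∈ S, ∀ i : Fin n, i.val + 1 = n → α i = 0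
  ne : ∀ α ∈ S, ∀ i j : Fin n, i.val + 1 = j.val → α i ≠ α j
  swap : ∀ α ∈ S, ∀ i j : Fin n, i.val + 1 = j.val → α i ≠ α j + 1 → α i ≠ α j - 1 →
    α ∘ Equiv.swap i j ∈ S
  braid : ∀ α ∈ S, ∀ i j k : Fin n, i.val + 1 = j.val → j.val + 1 = k.val → α i = α k →
    α j ≠ α i + 1 ∧ α j ≠ α i - 1

theorem IsWeightSet.exists_neighbour {n : ℕ} {S : Set (Fin n → ℂ)} (hS : IsWeightSet S)
    {α : Fin n → ℂ} (hα : α ∈ S) (i : Fin n) (hi : α i ≠ 0) :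
    ∃ k, i < k ∧ (α k = α i + 1 ∨ α k = α i - 1) := by
  induction i using WellFoundedGT.induction generalizing α with
  | ind i ih =>
    by_cases hl : i.val + 1 = n
    · exact absurd (hS.last α hα i hl) hi
    set j : Fin n := ⟨i.val + 1, by have := i.2; omega⟩ with hj
    have hij : i.val + 1 = j.val := rfl
    have hlt : i < j := by rw [Fin.lt_def]; omega
    by_cases h : α j = α i + 1 ∨ α j = α i - 1
    · exact ⟨j, hlt, h⟩
    push Not at h
    have := hS.swap α hα i j hij (fun h' => h.2 (by rw [h']; ring)) (fun h' => h.1 (by rw [h']; ring))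
    obtain ⟨k, hk, hk'⟩ := ih j hlt this (by simpa using hi)
    refine ⟨k, hlt.trans hk, ?_⟩
    rw [Function.comp_apply, Function.comp_apply, Equiv.swap_apply_right,
      Equiv.swap_apply_of_ne_of_ne (hlt.trans hk).ne' hk.ne'] at hk'
    exact hk'

theorem IsWeightSet.exists_between {n : ℕ} {S : Set (Fin n → ℂ)} (hS : IsWeightSet S)
    (d : ℕ) {α : Fin n → ℂ} (hα : α ∈ S) (i j : Fin n) (hij : i.val + d = j.val) (hd : i < j)
    (h : α i = α j) :
    (∃ k, i < k ∧ k < j ∧ α k = α i + 1) ∧ (∃ k, i < k ∧ k < j ∧ α k = α i - 1) := by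
  induction d using Nat.strong_induction_on generalizing α i j with
  | _ d ih =>
    rw [Fin.lt_def] at hd
    set a : Fin n := ⟨i.val + 1, by have := j.2; omega⟩ with ha
    have hia : i.val + 1 = a.val := rfl
    have hne := hS.ne α hα i a hia
    have haj : a ≠ j := fun h' => hne (h' ▸ h)
    have haj' : a.val < j.val := by
      rw [Ne, Fin.ext_iff] at haj
      omega
    set b : Fin n := ⟨j.val - 1, by have := j.2; omega⟩ with hb
    have hbj : b.val + 1 = j.val := by simp [hb]; omega
    have hne' := hS.ne α hα b j hbj
    by_cases h1 : α a = α i + 1 ∨ α a = α i - 1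
    swap
    · push Not at h1
      have hsw := hS.swap α hα i a hia (fun h' => h1.2 (by rw [h']; ring))
        (fun h' => h1.1 (by rw [h']; ring))
      have hfix : ∀ k, a < k → (α ∘ Equiv.swap i a) k = α k := fun k hk => by
        rw [Fin.lt_def] at hk
        rw [Function.comp_apply, Equiv.swap_apply_of_ne_of_ne]
        · rintro rfl; omega
        · rintro rfl; omega
      have hfa : (α ∘ Equiv.swap i a) a = α i := by simp
      obtain ⟨⟨k, h2, h3, h4⟩, ⟨l, h5, h6, h7⟩⟩ := ih (d - 1) (by omega) hsw a j (by omega) haj'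
        (by rw [hfa, hfix j haj', h])
      rw [hfa, hfix _ h2] at h4
      rw [hfa, hfix _ h5] at h7
      rw [Fin.lt_def] at h2 h5
      exact ⟨⟨k, by rw [Fin.lt_def]; omega, h3, h4⟩, ⟨l, by rw [Fin.lt_def]; omega, h6, h7⟩⟩
    by_cases h2 : α b = α i + 1 ∨ α b = α i - 1
    swap
    · push Not at h2
      have hsw := hS.swap α hα b j hbj (by rw [← h]; exact h2.1) (by rw [← h]; exact h2.2)
      have hfix : ∀ k, k < b → (α ∘ Equiv.swap b j) k = α k := fun k hk => by
        rw [Fin.lt_def] at hk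
        rw [Function.comp_apply, Equiv.swap_apply_of_ne_of_ne]
        · rintro rfl; omega
        · rintro rfl; omega
      have hfb : (α ∘ Equiv.swap b j) b = α i := by simp [h]
      have hib : i < b := by rw [Fin.lt_def]; omega
      obtain ⟨⟨k, h3, h4, h5⟩, ⟨l, h6, h7, h8⟩⟩ := ih (d - 1) (by omega) hsw i b (by omega) hib
        (by rw [hfb, hfix i hib])
      rw [hfix i hib, hfix _ h4] at h5
      rw [hfix i hib, hfix _ h7] at h8
      rw [Fin.lt_def] at h4 h7
      exact ⟨⟨k, h3, by rw [Fin.lt_def]; omega, h5⟩, ⟨l, h6, by rw [Fin.lt_def]; omega, h8⟩⟩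
    have hai : i < a := by rw [Fin.lt_def]; omega
    have hbj' : b < j := by rw [Fin.lt_def]; omega
    have hib : i < b := by rw [Fin.lt_def]; omega
    have same : α a = α b → (∃ k, i < k ∧ k < j ∧ α k = α i + 1) ∧
        (∃ k, i < k ∧ k < j ∧ α k = α i - 1) := by
      intro hab
      by_cases hab' : a = b
      · exact absurd h1 (by
          have := hS.braid α hα i a j hia (by rw [hab']; exact hbj) h
          tauto)
      have hlt : a < b := by
        rw [Fin.ext_iff] at hab'
        rw [Fin.lt_def]; omega
      obtain ⟨k, hak, hkb, hk⟩ : ∃ k, a < k ∧ k < b ∧ α k = α i := by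
        obtain ⟨⟨k, h3, h4, h5⟩, ⟨l, h6, h7, h8⟩⟩ :=
          ih (b.val - a.val) (by omega) hα a b (by omega) hlt hab
        rcases h1 with h1 | h1
        · exact ⟨l, h6, h7, by rw [h8, h1]; ring⟩
        · exact ⟨k, h3, h4, by rw [h5, h1]; ring⟩
      rw [Fin.lt_def] at hak hkb
      obtain ⟨⟨l, h3, h4, h5⟩, ⟨m, h6, h7, h8⟩⟩ :=
        ih (k.val - i.val) (by omega) hα i k (by omega) (by rw [Fin.lt_def]; omega) hk.symm
      rw [Fin.lt_def] at h4 h7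
      exact ⟨⟨l, h3, by rw [Fin.lt_def]; omega, h5⟩, ⟨m, h6, by rw [Fin.lt_def]; omega, h8⟩⟩
    rcases h1 with h1 | h1 <;> rcases h2 with h2 | h2
    · exact same (h1.trans h2.symm)
    · exact ⟨⟨a, hai, haj', h1⟩, ⟨b, hib, hbj', h2⟩⟩
    · exact ⟨⟨b, hib, hbj', h2⟩, ⟨a, hai, haj', h1⟩⟩
    · exact same (h1.trans h2.symm)

theorem IsWeightSet.exists_isStd {n : ℕ} {S : Set (Fin n → ℂ)} (hS : IsWeightSet S)
    {α : Fin n → ℂ} (hα : α ∈ S) :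
    ∃ p, IsStd p ∧ α = fun i => (cellContent (p i) : ℂ) := by
  have hαint : ∀ i, ∃ m : ℤ, α i = m := by
    intro i
    induction i using WellFoundedGT.induction with
    | ind i ih =>
      by_cases h : α i = 0
      · exact ⟨0, by simpa using h⟩
      obtain ⟨k, hk, hk'⟩ := hS.exists_neighbour hα i h
      obtain ⟨m, hm⟩ := ih k hk
      rw [hm] at hk'
      rcases hk' with h1 | h1
      · exact ⟨m - 1, by push_cast; rw [h1]; ring⟩
      · exact ⟨m + 1, by push_cast; rw [h1]; ring⟩
  choose β hβ using hαint
  obtain ⟨p, hp, h⟩ := exists_isStd_of_int β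
    (fun i hi => by
      have := hS.exists_neighbour hα i (by rw [hβ]; exact_mod_cast hi)
      simp only [hβ] at this
      exact_mod_cast this)
    (fun i j hij h => by
      have := hS.exists_between (j.val - i.val) hα i j (by rw [Fin.lt_def] at hij; omega) hij
        (by rw [hβ, hβ, h])
      simp only [hβ] at this
      exact_mod_cast this)
  exact ⟨p, hp, funext fun i => by rw [h, hβ]⟩

open Classical in
/-- The cells that can be added to the diagram `s`. -/
noncomputable def addable (s : Finset (ℕ × ℕ)) : Finset (ℕ × ℕ) :=
  (insert (0, 0) (s.image (fun x => (x.1 + 1, x.2)) ∪ s.image fun x => (x.1, x.2 + 1))).filter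
    fun x => x ∉ s ∧ IsLowerSet (↑(insert x s) : Set (ℕ × ℕ))

open Classical in
/-- The cells that can be removed from the diagram `s`. -/
noncomputable def corners (s : Finset (ℕ × ℕ)) : Finset (ℕ × ℕ) :=
  s.filter fun x => IsLowerSet (↑(s.erase x) : Set (ℕ × ℕ))

theorem mem_corners {s : Finset (ℕ × ℕ)} {x : ℕ × ℕ} :
    x ∈ corners s ↔ x ∈ s ∧ IsLowerSet (↑(s.erase x) : Set (ℕ × ℕ)) := by
  classical
  exact Finset.mem_filter

theorem mem_addable {s : Finset (ℕ × ℕ)} {x : ℕ × ℕ} :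
    x ∈ addable s ↔ x ∉ s ∧ IsLowerSet (↑(insert x s) : Set (ℕ × ℕ)) := by
  classical
  unfold addable
  rw [Finset.mem_filter, and_iff_right_iff_imp]
  rintro ⟨hx, hl⟩
  obtain ⟨i, j⟩ := x
  have key : ∀ y, y ≤ (i, j) → y ≠ (i, j) → y ∈ s := fun y h1 h2 => by
    have := hl h1 (by simp)
    simpa [h2] using this
  simp only [Finset.mem_insert, Finset.mem_union, Finset.mem_image]
  rcases Nat.eq_zero_or_pos i with rfl | hi
  · rcases Nat.eq_zero_or_pos j with rfl | hj
    · left; rfl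
    · right; right
      exact ⟨(0, j - 1), key _ (by simp) (by simp; omega), by simp; omega⟩
  · right; left
    exact ⟨(i - 1, j), key _ (by simp) (by simp; omega), by simp; omega⟩

theorem mem_corners_iff_rowLen (μ : YoungDiagram) (x : ℕ × ℕ) :
    x ∈ corners μ.cells ↔ x.2 + 1 = μ.rowLen x.1 ∧ μ.rowLen (x.1 + 1) ≤ x.2 := by
  obtain ⟨i, j⟩ := x
  rw [mem_corners, YoungDiagram.mem_cells, YoungDiagram.mem_iff_lt_rowLen]
  constructor
  · rintro ⟨h1, h2⟩
    have key : ∀ y : ℕ × ℕ, (i, j) ≤ y → y ≠ (i, j) → y ∉ μ := fun y h3 h4 h5 => by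
      have := h2 h3 (by simpa [h4] using h5)
      simp at this
    have h3 := key (i, j + 1) (by simp) (by simp)
    have h4 := key (i + 1, j) (by simp) (by simp)
    rw [YoungDiagram.mem_iff_lt_rowLen] at h3 h4
    simp only
    omega
  · rintro ⟨h1, h2⟩
    simp only at h1 h2
    refine ⟨by omega, ?_⟩
    rintro ⟨a, b⟩ ⟨c, d⟩ hle hab
    simp only [Finset.coe_erase, Set.mem_sdiff, Finset.mem_coe, YoungDiagram.mem_cells,
      Set.mem_singleton_iff] at hab ⊢
    refine ⟨μ.isLowerSet hle hab.1, fun heq => ?_⟩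
    have h3 := YoungDiagram.mem_iff_lt_rowLen.1 hab.1
    rw [heq] at hle
    obtain ⟨h4, h5⟩ := Prod.mk_le_mk.1 hle
    refine hab.2 ?_
    rcases h4.lt_or_eq with h6 | rfl
    · have := μ.rowLen_anti (i + 1) a h6
      omega
    · rw [Prod.mk.injEq]
      exact ⟨rfl, by omega⟩

theorem mem_addable_iff_rowLen (μ : YoungDiagram) (x : ℕ × ℕ) :
    x ∈ addable μ.cells ↔ x.2 = μ.rowLen x.1 ∧ (x.1 = 0 ∨ x.2 < μ.rowLen (x.1 - 1)) := by
  obtain ⟨i, j⟩ := x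
  rw [mem_addable, YoungDiagram.mem_cells, YoungDiagram.mem_iff_lt_rowLen]
  constructor
  · rintro ⟨h1, h2⟩
    have key : ∀ y : ℕ × ℕ, y ≤ (i, j) → y ≠ (i, j) → y ∈ μ := fun y h3 h4 => by
      have := h2 h3 (by simp)
      simpa [h4] using this
    simp only
    constructor
    · by_contra hne
      have := key (i, j - 1) (by simp) (by simp; omega)
      rw [YoungDiagram.mem_iff_lt_rowLen] at this
      omega
    · by_contra! hne
      have := key (i - 1, j) (by simp) (by simp; omega)
      rw [YoungDiagram.mem_iff_lt_rowLen] at this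
      omega
  · rintro ⟨h1, h2⟩
    simp only at h1 h2
    refine ⟨by omega, ?_⟩
    rintro ⟨a, b⟩ ⟨c, d⟩ hle hab
    simp only [Finset.coe_insert, Set.mem_insert_iff, Finset.mem_coe, YoungDiagram.mem_cells]
      at hab ⊢
    rcases hab with hab | hab
    · rw [hab] at hle
      obtain ⟨h4, h5⟩ := Prod.mk_le_mk.1 hle
      by_cases h6 : c = i
      · subst h6
        by_cases h7 : d = j
        · left; rw [h7]
        · right; rw [YoungDiagram.mem_iff_lt_rowLen]; omega
      · right
        rw [YoungDiagram.mem_iff_lt_rowLen]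
        have := μ.rowLen_anti c (i - 1) (by omega)
        omega
    · exact Or.inr (μ.isLowerSet hle hab)

theorem card_addable {s : Finset (ℕ × ℕ)} (hs : IsLowerSet (s : Set (ℕ × ℕ))) :
    (addable s).card = (corners s).card + 1 := by
  set μ : YoungDiagram := ⟨s, hs⟩ with hμ
  have h0 : (0, μ.rowLen 0) ∈ addable s := (mem_addable_iff_rowLen μ _).2 (by simp)
  rw [← Finset.card_erase_add_one h0]
  congr 1
  symm
  refine Finset.card_bij (fun x _ => (x.1 + 1, μ.rowLen (x.1 + 1))) ?_ ?_ ?_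
  · intro x hx
    have := (mem_corners_iff_rowLen μ x).1 hx
    rw [Finset.mem_erase]
    refine ⟨by simp, (mem_addable_iff_rowLen μ _).2 ?_⟩
    simp only [Nat.add_sub_cancel, true_and]
    omega
  · intro x hx y hy hxy
    have h1 := (mem_corners_iff_rowLen μ x).1 hx
    have h2 := (mem_corners_iff_rowLen μ y).1 hy
    have h3 : x.1 = y.1 := by simpa using congrArg Prod.fst hxy
    refine Prod.ext h3 ?_
    rw [h3] at h1
    omega
  · rintro ⟨i, j⟩ hx
    rw [Finset.mem_erase] at hx
    have h1 := (mem_addable_iff_rowLen μ _).1 hx.2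
    simp only at h1
    have hi : i ≠ 0 := by
      rintro rfl
      exact hx.1 (by rw [h1.1])
    have hi' : i - 1 + 1 = i := by omega
    refine ⟨(i - 1, μ.rowLen (i - 1) - 1), (mem_corners_iff_rowLen μ _).2 ?_, ?_⟩
    · simp only [hi']
      omega
    · simp only [hi', h1.1]

/-- Standard fillings by `n` entries. -/
abbrev Tab (n : ℕ) := {p : Fin n → ℕ × ℕ // IsStd p}

/-- The shape of a filling. -/
def shape {n : ℕ} (p : Fin n → ℕ × ℕ) : Finset (ℕ × ℕ) := Finset.univ.image p

theorem coe_shape {n : ℕ} (p : Fin n → ℕ × ℕ) : (shape p : Set (ℕ × ℕ)) = Set.range p := by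
  simp [shape]

theorem shape_cons {n : ℕ} (x : ℕ × ℕ) (p : Fin n → ℕ × ℕ) :
    shape (Fin.cons x p : Fin (n + 1) → ℕ × ℕ) = insert x (shape p) := by
  rw [← Finset.coe_inj, coe_shape, Fin.range_cons, Finset.coe_insert, coe_shape]

theorem shape_lower {n : ℕ} (p : Tab n) : IsLowerSet (shape p.1 : Set (ℕ × ℕ)) := by
  rw [coe_shape]; exact p.2.lower

theorem card_shape {n : ℕ} (p : Tab n) : (shape p.1).card = n := by
  rw [shape, Finset.card_image_of_injective _ p.2.injective, Finset.card_univ, Fintype.card_fin]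

theorem isStd_cons' {n : ℕ} {p : Fin n → ℕ × ℕ} {x : ℕ × ℕ} :
    IsStd (Fin.cons x p : Fin (n + 1) → ℕ × ℕ) ↔ IsStd p ∧ x ∈ addable (shape p) := by
  rw [isStd_cons, mem_addable, Finset.coe_insert, ← Finset.mem_coe, coe_shape]

/-- Removing the largest entry of a filling. -/
def tabEquiv (n : ℕ) : Tab (n + 1) ≃ Σ q : Tab n, addable (shape q.1) where
  toFun p := ⟨⟨Fin.tail p.1, (isStd_cons'.1 (by rw [Fin.cons_self_tail]; exact p.2)).1⟩,
    ⟨p.1 0, (isStd_cons'.1 (by rw [Fin.cons_self_tail]; exact p.2)).2⟩⟩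
  invFun q := ⟨Fin.cons q.2.1 q.1.1, isStd_cons'.2 ⟨q.1.2, q.2.2⟩⟩
  left_inv p := by simp
  right_inv q := by
    obtain ⟨⟨q, hq⟩, ⟨x, hx⟩⟩ := q
    rfl

instance (n : ℕ) : Finite (Tab n) := by
  induction n with
  | zero => infer_instance
  | succ n ih => exact Finite.of_equiv _ (tabEquiv n).symm

noncomputable instance (n : ℕ) : Fintype (Tab n) := Fintype.ofFinite _

theorem sum_tab_succ {n : ℕ} (g : Finset (ℕ × ℕ) → ℕ) :
    ∑ p : Tab (n + 1), g (shape p.1) =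
      ∑ q : Tab n, ∑ x ∈ addable (shape q.1), g (insert x (shape q.1)) := by
  rw [← (tabEquiv n).symm.sum_comp, Fintype.sum_sigma]
  refine Finset.sum_congr rfl fun q _ => ?_
  rw [← Finset.sum_coe_sort (addable (shape q.1))]
  refine Finset.sum_congr rfl fun x _ => ?_
  rw [← shape_cons]
  rfl

/-- The number of standard fillings of a shape. -/
noncomputable def numTab (n : ℕ) (s : Finset (ℕ × ℕ)) : ℕ :=
  ∑ p : Tab n, if shape p.1 = s then 1 else 0

theorem numTab_succ (n : ℕ) {s : Finset (ℕ × ℕ)} (hs : IsLowerSet (s : Set (ℕ × ℕ))) :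
    numTab (n + 1) s = ∑ x ∈ corners s, numTab n (s.erase x) := by
  unfold numTab
  rw [sum_tab_succ fun t => if t = s then 1 else 0, Finset.sum_comm]
  refine Finset.sum_congr rfl fun q _ => ?_
  rw [← Finset.sum_filter, ← Finset.sum_filter]
  congr 1
  ext x
  rw [Finset.mem_filter, Finset.mem_filter, mem_addable, mem_corners]
  constructor
  · rintro ⟨⟨h1, -⟩, rfl⟩
    rw [Finset.erase_insert h1]
    exact ⟨⟨by simp, shape_lower q⟩, rfl⟩
  · rintro ⟨⟨h1, -⟩, h2⟩
    rw [h2, Finset.insert_erase h1]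
    exact ⟨⟨by simp, hs⟩, rfl⟩

theorem sum_numTab_addable (n : ℕ) {s : Finset (ℕ × ℕ)} (hs : IsLowerSet (s : Set (ℕ × ℕ)))
    (hn : s.card = n) :
    ∑ x ∈ addable s, numTab (n + 1) (insert x s) = (n + 1) * numTab n s := by
  induction n generalizing s with
  | zero =>
    obtain rfl := Finset.card_eq_zero.1 hn
    have hc : corners ∅ = ∅ :=
      Finset.eq_empty_of_forall_notMem fun x hx => by simpa using (mem_corners.1 hx).1
    have ha : addable ∅ = {(0, 0)} := by
      ext x
      have := mem_addable_iff_rowLen ⊥ x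
      have h0 : ∀ i, YoungDiagram.rowLen ⊥ i = 0 := fun i => by
        by_contra h
        exact YoungDiagram.notMem_bot (i, 0)
          (YoungDiagram.mem_iff_lt_rowLen.2 (Nat.pos_of_ne_zero h))
      simp only [h0, YoungDiagram.cells_bot] at this
      rw [this, Finset.mem_singleton, Prod.ext_iff]
      simp only
      omega
    have hl : corners {(0, 0)} = {(0, 0)} := by
      ext x
      rw [mem_corners, Finset.mem_singleton, and_iff_left_iff_imp]
      rintro rfl
      simpa using isLowerSet_empty
    rw [ha, Finset.sum_singleton, numTab_succ _
      (mem_addable.1 (ha ▸ Finset.mem_singleton_self (0, 0))).2]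
    simp [hl]
  | succ n ih =>
    have off : ∑ x ∈ addable s, ∑ y ∈ (corners (insert x s)).erase x,
          numTab (n + 1) ((insert x s).erase y) =
        ∑ y ∈ corners s, ∑ x ∈ (addable (s.erase y)).erase y,
          numTab (n + 1) (insert x (s.erase y)) := by
      have : ∀ x y, x ∈ addable s ∧ y ∈ (corners (insert x s)).erase x ↔
          x ∈ (addable (s.erase y)).erase y ∧ y ∈ corners s := by
        intro x y
        simp only [Finset.mem_erase, mem_addable, mem_corners, Finset.mem_insert]
        constructor
        · rintro ⟨⟨h1, h2⟩, h3, h4, h5⟩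
          have h6 : y ∈ s := h4.resolve_left h3
          rw [Finset.erase_insert_of_ne (Ne.symm h3)] at h5
          refine ⟨⟨Ne.symm h3, fun h => h1 h.2, h5⟩, h6, ?_⟩
          have := h5.inter hs
          convert this using 1
          ext z
          simp only [Finset.coe_erase, Finset.coe_insert, Set.mem_sdiff, Set.mem_inter_iff,
            Set.mem_insert_iff, Finset.mem_coe, Set.mem_singleton_iff]
          constructor
          · exact fun h => ⟨Or.inr h, h.1⟩
          · rintro ⟨rfl | h, h'⟩
            · exact absurd h' h1
            · exact h
        · rintro ⟨⟨h1, h2, h3⟩, h4, h5⟩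
          have h6 : x ∉ s := fun h => h2 ⟨h1, h⟩
          refine ⟨⟨h6, ?_⟩, Ne.symm h1, Or.inr h4, ?_⟩
          · have := h3.union hs
            convert this using 1
            ext z
            simp only [Finset.coe_erase, Finset.coe_insert, Set.mem_sdiff, Set.mem_union,
              Set.mem_insert_iff, Finset.mem_coe, Set.mem_singleton_iff]
            tauto
          · rw [Finset.erase_insert_of_ne h1]
            exact h3
      rw [Finset.sum_comm' this]
      refine Finset.sum_congr rfl fun y _ => Finset.sum_congr rfl fun x hx => ?_
      rw [Finset.erase_insert_of_ne (Finset.ne_of_mem_erase hx)]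
    have h1 : ∑ x ∈ addable s, numTab (n + 1 + 1) (insert x s) =
        (addable s).card * numTab (n + 1) s + ∑ x ∈ addable s,
          ∑ y ∈ (corners (insert x s)).erase x, numTab (n + 1) ((insert x s).erase y) := by
      rw [← smul_eq_mul, ← Finset.sum_const, ← Finset.sum_add_distrib]
      refine Finset.sum_congr rfl fun x hx => ?_
      rw [mem_addable] at hx
      have hxc : x ∈ corners (insert x s) := by
        rw [mem_corners, Finset.erase_insert hx.1]
        exact ⟨by simp, hs⟩
      rw [numTab_succ _ hx.2, ← Finset.add_sum_erase _ _ hxc, Finset.erase_insert hx.1]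
    have h2 : (n + 1) * numTab (n + 1) s = (corners s).card * numTab (n + 1) s +
        ∑ y ∈ corners s, ∑ x ∈ (addable (s.erase y)).erase y,
          numTab (n + 1) (insert x (s.erase y)) := by
      rw [← smul_eq_mul (corners s).card, ← Finset.sum_const, ← Finset.sum_add_distrib,
        numTab_succ n hs, Finset.mul_sum, numTab_succ n hs |>.symm]
      refine Finset.sum_congr rfl fun y hy => ?_
      rw [mem_corners] at hy
      rw [← ih hy.2 (by rw [Finset.card_erase_of_mem hy.1]; omega)]
      have hya : y ∈ addable (s.erase y) := by
        rw [mem_addable, Finset.insert_erase hy.1]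
        exact ⟨by simp, hs⟩
      rw [← Finset.add_sum_erase _ _ hya, Finset.insert_erase hy.1]
    rw [h1, off, card_addable hs, add_mul, add_right_comm, ← h2]
    ring

theorem sum_numTab (n : ℕ) : ∑ p : Tab n, numTab n (shape p.1) = n.factorial := by
  induction n with
  | zero =>
    have : ∀ p q : Tab 0, p = q := fun p q => Subsingleton.elim _ _
    unfold numTab
    have h : Fintype.card (Tab 0) = 1 := Fintype.card_eq_one_iff.2
      ⟨⟨Fin.elim0, ⟨fun a b _ ⟨k, _⟩ => k.elim0, fun i => i.elim0⟩⟩, fun q => this _ _⟩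
    rw [Finset.sum_congr rfl fun p _ => Finset.sum_congr rfl fun q _ =>
      if_pos (by rw [this p q])]
    simp [h]
  | succ n ih =>
    rw [sum_tab_succ, Nat.factorial_succ, ← ih, Finset.mul_sum]
    exact Finset.sum_congr rfl fun q _ => sum_numTab_addable n (shape_lower q) (card_shape q)

/-- Pairs of standard fillings of the same shape. -/
abbrev TabPair (n : ℕ) := {p : Tab n × Tab n // shape p.1.1 = shape p.2.1}

theorem card_tabPair (n : ℕ) : Fintype.card (TabPair n) = n.factorial := by
  classical
  rw [← sum_numTab, Fintype.card_subtype, Finset.card_filter, Fintype.sum_prod_type_right]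
  rfl

section Representation

variable {n : ℕ} {E : Type*} [NormedAddCommGroup E] [InnerProductSpace ℂ E]

/-- A representation of the symmetric group by unitary operators. -/
def IsUnitaryRep (ρ : Perm (Fin n) →* Module.End ℂ E) : Prop :=
  ∀ g x y, inner ℂ (ρ g x) y = inner ℂ x (ρ g⁻¹ y)

/-- The Jucys-Murphy operators. -/
noncomputable def jm (ρ : Perm (Fin n) →* Module.End ℂ E) (i : Fin n) : Module.End ℂ E :=
  ∑ j ∈ Finset.Ioi i, ρ (Equiv.swap i j)

/-- The joint eigenspaces of the Jucys-Murphy operators. -/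
noncomputable def wt (ρ : Perm (Fin n) →* Module.End ℂ E) (α : Fin n → ℂ) : Submodule ℂ E :=
  ⨅ i, Module.End.eigenspace (jm ρ i) (α i)

variable {ρ : Perm (Fin n) →* Module.End ℂ E}

theorem mem_wt {α : Fin n → ℂ} {v : E} : v ∈ wt ρ α ↔ ∀ i, jm ρ i v = α i • v := by
  simp [wt, Submodule.mem_iInf]

theorem jm_isSymmetric (hρ : IsUnitaryRep ρ) (i : Fin n) : (jm ρ i).IsSymmetric := by
  intro x y
  simp only [jm, LinearMap.sum_apply, sum_inner, inner_sum]
  exact Finset.sum_congr rfl fun j _ => by rw [hρ, Equiv.swap_inv]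

theorem commute_jm_swap_of_lt {i j k : Fin n} (hj : i < j) (hk : i < k) :
    Commute (jm ρ i) (ρ (Equiv.swap j k)) := by
  unfold Commute SemiconjBy jm
  rw [Finset.sum_mul, Finset.mul_sum]
  refine Finset.sum_bij' (fun l _ => Equiv.swap j k l) (fun l _ => Equiv.swap j k l) ?_ ?_ ?_ ?_ ?_
  · intro l hl
    rw [Finset.mem_Ioi] at hl ⊢
    rw [Equiv.swap_apply_def]
    split_ifs <;> assumption
  · intro l hl
    rw [Finset.mem_Ioi] at hl ⊢
    rw [Equiv.swap_apply_def]
    split_ifs <;> assumption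
  · simp
  · simp
  · intro l hl
    rw [← map_mul, ← map_mul, Equiv.mul_swap_eq_swap_mul (Equiv.swap j k), Equiv.swap_apply_self,
      Equiv.swap_apply_of_ne_of_ne hj.ne hk.ne]

theorem commute_jm_swap_of_gt {i j a : Fin n} (hi : i < a) (hj : j < a) :
    Commute (jm ρ a) (ρ (Equiv.swap i j)) := by
  unfold jm
  refine Commute.sum_left _ _ _ fun l hl => ?_
  rw [Finset.mem_Ioi] at hl
  unfold Commute SemiconjBy
  rw [← map_mul, ← map_mul, Equiv.mul_swap_eq_swap_mul,
    Equiv.swap_apply_of_ne_of_ne hi.ne (hi.trans hl).ne,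
    Equiv.swap_apply_of_ne_of_ne hj.ne (hj.trans hl).ne]

theorem commute_jm (i j : Fin n) : Commute (jm ρ i) (jm ρ j) := by
  have key : ∀ i j : Fin n, i < j → Commute (jm ρ i) (jm ρ j) := fun i j hij =>
    Commute.sum_right _ _ _ fun l hl =>
      commute_jm_swap_of_lt hij (hij.trans (Finset.mem_Ioi.1 hl))
  rcases lt_trichotomy i j with h | rfl | h
  · exact key i j h
  · exact Commute.refl _
  · exact (key j i h).symm

theorem swap_mul_self (i j : Fin n) : ρ (Equiv.swap i j) * ρ (Equiv.swap i j) = 1 := by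
  rw [← map_mul, Equiv.swap_mul_self, map_one]

theorem swap_mul_jm {i j : Fin n} (hij : i.val + 1 = j.val) :
    ρ (Equiv.swap i j) * jm ρ i = jm ρ j * ρ (Equiv.swap i j) + 1 := by
  have hI : Finset.Ioi i = insert j (Finset.Ioi j) := by
    ext k
    simp only [Finset.mem_Ioi, Finset.mem_insert, Fin.lt_def, Fin.ext_iff]
    omega
  unfold jm
  rw [hI, Finset.sum_insert (by simp), mul_add, swap_mul_self, add_comm, Finset.mul_sum,
    Finset.sum_mul]
  congr 1
  refine Finset.sum_congr rfl fun k hk => ?_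
  rw [Finset.mem_Ioi] at hk
  have hlt : i < j := by rw [Fin.lt_def]; omega
  rw [← map_mul, ← map_mul, Equiv.mul_swap_eq_swap_mul, Equiv.swap_apply_left,
    Equiv.swap_apply_of_ne_of_ne (hlt.trans hk).ne' hk.ne']

theorem jm_mul_swap {i j : Fin n} (hij : i.val + 1 = j.val) :
    jm ρ i * ρ (Equiv.swap i j) = ρ (Equiv.swap i j) * jm ρ j + 1 := by
  have h := congrArg (fun x => ρ (Equiv.swap i j) * x * ρ (Equiv.swap i j))
    (swap_mul_jm (ρ := ρ) hij)
  simpa only [mul_add, add_mul, mul_assoc, swap_mul_self, mul_one, ← mul_assoc (ρ _) (ρ _),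
    one_mul] using h

theorem jm_apply_swap {i j : Fin n} (hij : i.val + 1 = j.val) (v : E) :
    jm ρ i (ρ (Equiv.swap i j) v) = ρ (Equiv.swap i j) (jm ρ j v) + v :=
  LinearMap.congr_fun (jm_mul_swap hij) v

theorem jm_apply_swap' {i j : Fin n} (hij : i.val + 1 = j.val) (v : E) :
    jm ρ j (ρ (Equiv.swap i j) v) = ρ (Equiv.swap i j) (jm ρ i v) - v := by
  rw [eq_sub_iff_add_eq]
  exact (LinearMap.congr_fun (swap_mul_jm (ρ := ρ) hij) v).symm

/-- The intertwiner between weight spaces of adjacent weights. -/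
theorem swap_sub_mem_wt {i j : Fin n} (hij : i.val + 1 = j.val) {α : Fin n → ℂ} {v : E}
    (hv : v ∈ wt ρ α) {c : ℂ} (hc : c * (α i - α j) = 1) :
    ρ (Equiv.swap i j) v - c • v ∈ wt ρ (α ∘ Equiv.swap i j) := by
  rw [mem_wt] at hv ⊢
  have hlt : i < j := by rw [Fin.lt_def]; omega
  intro a
  rw [map_sub, map_smul]
  by_cases hai : a = i
  · subst hai
    rw [jm_apply_swap hij, hv, hv, Function.comp_apply, Equiv.swap_apply_left, map_smul,
      show c • α a • v = (1 + c * α j) • v by rw [← hc, smul_smul]; congr 1; ring]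
    module
  by_cases haj : a = j
  · subst haj
    rw [jm_apply_swap' hij, hv, hv, Function.comp_apply, Equiv.swap_apply_right, map_smul,
      show c • α a • v = (c * α i - 1) • v by rw [← hc, smul_smul]; congr 1; ring]
    module
  · have hcomm : Commute (jm ρ a) (ρ (Equiv.swap i j)) := by
      rcases lt_or_gt_of_ne hai with h | h
      · exact commute_jm_swap_of_lt h (h.trans hlt)
      · refine commute_jm_swap_of_gt h ?_
        rw [Fin.ext_iff] at haj
        rw [Fin.lt_def] at h ⊢
        omega
    rw [Function.comp_apply, Equiv.swap_apply_of_ne_of_ne hai haj,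
      show jm ρ a (ρ (Equiv.swap i j) v) = ρ (Equiv.swap i j) (jm ρ a v) from
        LinearMap.congr_fun hcomm.eq v, hv, map_smul]
    module

theorem inner_eq_zero_of_mem_wt (hρ : IsUnitaryRep ρ) {α β : Fin n → ℂ} (h : α ≠ β) {v w : E}
    (hv : v ∈ wt ρ α) (hw : w ∈ wt ρ β) : inner ℂ v w = 0 :=
  (LinearMap.IsSymmetric.orthogonalFamily_iInf_eigenspaces
    (fun i => jm_isSymmetric hρ i)).pairwise h.symm hw v hv

theorem comp_swap_ne {i j : Fin n} {α : Fin n → ℂ} (h : α i ≠ α j) : α ≠ α ∘ Equiv.swap i j :=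
  fun h' => h (by simpa using congrFun h' i)

theorem swap_apply_swap (i j : Fin n) (v : E) :
    ρ (Equiv.swap i j) (ρ (Equiv.swap i j) v) = v :=
  LinearMap.congr_fun (swap_mul_self i j) v

/-- Adjacent weights differing by `±1` give eigenvectors of the transposition. -/
theorem swap_apply_of_adjacent (hρ : IsUnitaryRep ρ) {i j : Fin n} (hij : i.val + 1 = j.val)
    {α : Fin n → ℂ} {v : E} (hv : v ∈ wt ρ α) {c : ℂ} (hc : c * c = 1) (h : α i = α j + c) :
    ρ (Equiv.swap i j) v = c • v := by
  have hc0 : c ≠ 0 := fun h0 => by simp [h0] at hc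
  have hu := swap_sub_mem_wt hij hv (c := c) (by rw [h]; ring_nf; rw [← hc]; ring)
  set u := ρ (Equiv.swap i j) v - c • v with hu'
  have hvu : inner ℂ v u = 0 :=
    inner_eq_zero_of_mem_wt hρ (comp_swap_ne (by rw [h]; simpa using hc0)) hv hu
  have hsu : ρ (Equiv.swap i j) u = -c • u := by
    rw [hu', map_sub, map_smul, swap_apply_swap, smul_sub, smul_smul,
      show -c * c = -1 by rw [neg_mul, hc]]
    module
  have huu : inner ℂ u u = 0 := by
    conv_lhs => rw [hu', inner_sub_left, inner_smul_left, ← hu', hvu, hρ, Equiv.swap_inv, hsu,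
      inner_smul_right, hvu]
    simp
  exact sub_eq_zero.1 (inner_self_eq_zero.1 huu)

theorem swap_sub_ne_zero {i j : Fin n} {α : Fin n → ℂ} {v : E} (hv0 : v ≠ 0)
    (h1 : α i ≠ α j + 1) (h2 : α i ≠ α j - 1) {c : ℂ} (hc : c * (α i - α j) = 1) :
    ρ (Equiv.swap i j) v - c • v ≠ 0 := by
  intro h
  rw [sub_eq_zero] at h
  have h3 := swap_apply_swap (ρ := ρ) i j v
  rw [h, map_smul, h, smul_smul] at h3
  have h4 : c * c = 1 := by
    have : (c * c - 1) • v = 0 := by rw [sub_smul, h3, one_smul, sub_self]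
    exact sub_eq_zero.1 ((smul_eq_zero.1 this).resolve_right hv0)
  rcases mul_self_eq_one_iff.1 h4 with rfl | rfl
  · exact h1 (by linear_combination hc)
  · exact h2 (by linear_combination -hc)

theorem wt_ne (hρ : IsUnitaryRep ρ) {i j : Fin n} (hij : i.val + 1 = j.val)
    {α : Fin n → ℂ} {v : E} (hv : v ∈ wt ρ α) (hv0 : v ≠ 0) : α i ≠ α j := by
  intro h
  have hv' := mem_wt.1 hv
  have h1 := jm_isSymmetric hρ i v (ρ (Equiv.swap i j) v)
  have h2 := jm_isSymmetric hρ j v (ρ (Equiv.swap i j) v)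
  rw [jm_apply_swap hij, hv', hv', map_smul, inner_add_right, h] at h1
  rw [jm_apply_swap' hij, hv', hv', map_smul, inner_sub_right, h, h1] at h2
  have : inner ℂ v v = 0 := by linear_combination h2 / 2
  exact hv0 (inner_self_eq_zero.1 this)

theorem isWeightSet (hρ : IsUnitaryRep ρ) : IsWeightSet {α | wt ρ α ≠ ⊥} where
  last α hα i hi := by
    obtain ⟨v, hv, hv0⟩ := Submodule.exists_mem_ne_zero_of_ne_bot hα
    have h := mem_wt.1 hv i
    have hI : Finset.Ioi i = ∅ := Finset.eq_empty_of_forall_notMem fun k hk => by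
      rw [Finset.mem_Ioi, Fin.lt_def] at hk
      omega
    rw [jm, hI, Finset.sum_empty, LinearMap.zero_apply] at h
    exact (smul_eq_zero.1 h.symm).resolve_right hv0
  ne α hα i j hij := by
    obtain ⟨v, hv, hv0⟩ := Submodule.exists_mem_ne_zero_of_ne_bot hα
    exact wt_ne hρ hij hv hv0
  swap α hα i j hij h1 h2 := by
    obtain ⟨v, hv, hv0⟩ := Submodule.exists_mem_ne_zero_of_ne_bot hα
    have hc := inv_mul_cancel₀ (sub_ne_zero.2 (wt_ne hρ hij hv hv0))
    exact fun hbot => swap_sub_ne_zero hv0 h1 h2 hc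
      ((Submodule.eq_bot_iff _).1 hbot _ (swap_sub_mem_wt hij hv hc))
  braid α hα i j k hij hjk hik := by
    obtain ⟨v, hv, hv0⟩ := Submodule.exists_mem_ne_zero_of_ne_bot hα
    have key : ∀ c : ℂ, c * c = 1 → α i ≠ α j + c := by
      intro c hc h
      have h1 := swap_apply_of_adjacent hρ hij hv hc h
      have h2 := swap_apply_of_adjacent hρ hjk hv (c := -c) (by rw [neg_mul_neg, hc])
        (by rw [← hik, h]; ring)
      have hne1 : i ≠ j := fun h => by rw [h] at hij; omega
      have hne2 : j ≠ k := fun h => by rw [h] at hjk; omega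
      have hne3 : i ≠ k := fun h => by rw [h] at hij; omega
      have hb : ρ (Equiv.swap i j * Equiv.swap j k * Equiv.swap i j) v =
          ρ (Equiv.swap j k * Equiv.swap i j * Equiv.swap j k) v := by
        have e1 : Equiv.swap i j * Equiv.swap j k * Equiv.swap i j = Equiv.swap i k := by
          rw [Equiv.swap_comm i j, Equiv.swap_comm j k]
          exact Equiv.swap_mul_swap_mul_swap hne2.symm hne3.symm
        have e2 : Equiv.swap j k * Equiv.swap i j * Equiv.swap j k = Equiv.swap k i :=
          Equiv.swap_mul_swap_mul_swap hne1 hne3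
        rw [e1, e2, Equiv.swap_comm]
      simp only [map_mul, Module.End.mul_apply, h1, h2, map_smul, smul_smul] at hb
      have hb' : (2 * c * (c * c)) • v = 0 := by
        rw [← sub_eq_zero, ← sub_smul] at hb
        rw [← neg_eq_zero, ← neg_smul, ← hb]
        congr 1
        ring
      rw [hc] at hb'
      have : c = 0 := by simpa [hv0] using hb'
      simp [this] at hc
    refine ⟨fun h => key (-1) (by norm_num) (by rw [h]; ring),
      fun h => key 1 (by norm_num) (by rw [h]; ring)⟩

end Representation

/-- The contents of a filling, as a weight. -/
def cont {n : ℕ} (p : Fin n → ℕ × ℕ) : Fin n → ℂ := fun i => (cellContent (p i) : ℂ)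

theorem cont_comp {n : ℕ} (p : Fin n → ℕ × ℕ) (g : Fin n → Fin n) :
    cont (p ∘ g) = cont p ∘ g := rfl

theorem shape_comp_perm {n : ℕ} (p : Fin n → ℕ × ℕ) (g : Perm (Fin n)) :
    shape (p ∘ g) = shape p := by
  rw [← Finset.coe_inj, coe_shape, coe_shape, EquivLike.range_comp]

theorem IsStd.swap_of_content {n : ℕ} {p : Fin n → ℕ × ℕ} (hp : IsStd p) {i j : Fin n}
    (hij : i.val + 1 = j.val) (h1 : cellContent (p i) ≠ cellContent (p j) + 1)
    (h2 : cellContent (p i) ≠ cellContent (p j) - 1) : IsStd (p ∘ Equiv.swap i j) :=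
  hp.swap hij fun h => (hp.content_of_le hij h).elim h1 h2

theorem sum_shape {n : ℕ} (p : Tab n) (F : ℕ × ℕ → ℤ) :
    ∑ x ∈ shape p.1, F x = ∑ i, F (p.1 i) := by
  rw [shape, Finset.sum_image fun i _ j _ h => p.2.injective h]

section Blocks

variable {n : ℕ} {E : Type*} [NormedAddCommGroup E] [InnerProductSpace ℂ E]
  {ρ : Perm (Fin n) →* Module.End ℂ E}

/-- The sum of the weight spaces for the fillings of a given shape. -/
noncomputable def blk (ρ : Perm (Fin n) →* Module.End ℂ E) (s : Finset (ℕ × ℕ)) :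
    Submodule ℂ E :=
  ⨆ p : {p : Tab n // shape p.1 = s}, wt ρ (cont p.1.1)

theorem wt_le_blk (p : Tab n) : wt ρ (cont p.1) ≤ blk ρ (shape p.1) :=
  le_iSup (fun p : {q : Tab n // shape q.1 = shape p.1} => wt ρ (cont p.1.1)) ⟨p, rfl⟩

theorem swap_mem_blk_of_mem_wt (hρ : IsUnitaryRep ρ) {i j : Fin n} (hij : i.val + 1 = j.val)
    (p : Tab n) {v : E} (hv : v ∈ wt ρ (cont p.1)) :
    ρ (Equiv.swap i j) v ∈ blk ρ (shape p.1) := by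
  by_cases h1 : cellContent (p.1 i) = cellContent (p.1 j) + 1
  · rw [swap_apply_of_adjacent hρ hij hv (c := 1) (by norm_num) (by simp [cont, h1])]
    exact Submodule.smul_mem _ _ (wt_le_blk p hv)
  by_cases h2 : cellContent (p.1 i) = cellContent (p.1 j) - 1
  · rw [swap_apply_of_adjacent hρ hij hv (c := -1) (by norm_num)
      (by simp [cont, h2, sub_eq_add_neg])]
    exact Submodule.smul_mem _ _ (wt_le_blk p hv)
  have hne : cont p.1 i - cont p.1 j ≠ 0 := by
    rw [sub_ne_zero]
    simpa [cont] using p.2.content_ne hij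
  have hu := swap_sub_mem_wt hij hv (inv_mul_cancel₀ hne)
  rw [← cont_comp] at hu
  have hu' := wt_le_blk (ρ := ρ) ⟨_, p.2.swap_of_content hij h1 h2⟩ hu
  rw [shape_comp_perm] at hu'
  rw [← sub_add_cancel (ρ (Equiv.swap i j) v) ((cont p.1 i - cont p.1 j)⁻¹ • v)]
  exact Submodule.add_mem _ hu' (Submodule.smul_mem _ _ (wt_le_blk p hv))

theorem swap_mem_blk (hρ : IsUnitaryRep ρ) {i j : Fin n} (hij : i.val + 1 = j.val)
    {s : Finset (ℕ × ℕ)} {v : E} (hv : v ∈ blk ρ s) : ρ (Equiv.swap i j) v ∈ blk ρ s := by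
  have : blk ρ s ≤ (blk ρ s).comap (ρ (Equiv.swap i j)) := by
    refine iSup_le ?_
    rintro ⟨p, rfl⟩ w hw
    exact swap_mem_blk_of_mem_wt hρ hij p hw
  exact this hv

/-- Induction on products of adjacent transpositions. -/
theorem perm_induction {P : Perm (Fin n) → Prop} (one : P 1)
    (swap_mul : ∀ i j : Fin n, i.val + 1 = j.val → ∀ g, P g → P (Equiv.swap i j * g))
    (g : Perm (Fin n)) : P g := by
  cases n with
  | zero => rwa [Subsingleton.elim g 1]
  | succ n =>
    have hg : g ∈ Submonoid.closure
        (Set.range fun i : Fin n => Equiv.swap i.castSucc i.succ) := by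
      rw [Equiv.Perm.mclosure_swap_castSucc_succ]
      trivial
    induction hg using Submonoid.closure_induction_left with
    | one => exact one
    | mul_left x hx y hy ih =>
      obtain ⟨i, rfl⟩ := hx
      exact swap_mul _ _ (by simp) _ ih

theorem map_mem_blk (hρ : IsUnitaryRep ρ) (g : Perm (Fin n)) {s : Finset (ℕ × ℕ)} {v : E}
    (hv : v ∈ blk ρ s) : ρ g v ∈ blk ρ s := by
  induction g using perm_induction with
  | one => simpa using hv
  | swap_mul i j hij g ih =>
    rw [map_mul]
    exact swap_mem_blk hρ hij ih

theorem iSup_wt [FiniteDimensional ℂ E] (hρ : IsUnitaryRep ρ) :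
    ⨆ p : Tab n, wt ρ (cont p.1) = ⊤ := by
  rw [eq_top_iff, ← LinearMap.IsSymmetric.iSup_iInf_eq_top_of_commute
    (fun i => jm_isSymmetric hρ i) fun i j _ => commute_jm i j]
  refine iSup_le fun α => ?_
  by_cases hα : wt ρ α = ⊥
  · rw [← wt, hα]
    exact bot_le
  · obtain ⟨p, hp, rfl⟩ := (isWeightSet hρ).exists_isStd hα
    exact le_iSup (fun p : Tab n => wt ρ (cont p.1)) ⟨p, hp⟩

theorem iSup_blk [FiniteDimensional ℂ E] (hρ : IsUnitaryRep ρ) :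
    ⨆ s, blk ρ s = ⊤ := by
  rw [eq_top_iff, ← iSup_wt hρ]
  exact iSup_le fun p => (wt_le_blk p).trans (le_iSup (blk ρ) _)

theorem exists_sorted_adjacent (hρ : IsUnitaryRep ρ) {s : Finset (ℕ × ℕ)} {y : E}
    (hy : y ∈ blk ρ s) (hy0 : y ≠ 0) {r : Fin n → ℕ} {ε : ℤ} (hε : ε * ε = 1)
    (h : ∀ i j : Fin n, i.val + 1 = j.val → r i = r j → ρ (Equiv.swap i j) y = (ε : ℂ) • y) :
    ∃ p : Tab n, shape p.1 = s ∧ ∀ i j : Fin n, i.val + 1 = j.val → r i = r j →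
      0 < ε * (cellContent (p.1 i) - cellContent (p.1 j)) := by
  have hex : ∃ p : Tab n, shape p.1 = s ∧ ∃ u ∈ wt ρ (cont p.1), inner ℂ u y ≠ 0 := by
    by_contra! hcon
    have hle : blk ρ s ≤ (ℂ ∙ y)ᗮ := by
      refine iSup_le fun p u hu => ?_
      rw [Submodule.mem_orthogonal_singleton_iff_inner_left]
      exact hcon p.1 p.2 u hu
    exact hy0 (inner_self_eq_zero.1
      (Submodule.mem_orthogonal_singleton_iff_inner_left.1 (hle hy)))
  let A := {p : Tab n // shape p.1 = s ∧ ∃ u ∈ wt ρ (cont p.1), inner ℂ u y ≠ 0}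
  have : Nonempty A := ⟨⟨_, hex.choose_spec⟩⟩
  obtain ⟨⟨p, hps, u, hu, huy⟩, hmin⟩ :=
    Finite.exists_min fun p : A => ∑ i : Fin n, (i.val : ℤ) * (ε * cellContent (p.1.1 i))
  refine ⟨p, hps, fun i j hij hr => ?_⟩
  have hε' : ε = 1 ∨ ε = -1 := mul_self_eq_one_iff.1 hε
  have hne := p.2.content_ne hij
  have hsy := h i j hij hr
  have hinner : inner ℂ (ρ (Equiv.swap i j) u) y = (ε : ℂ) * inner ℂ u y := by
    rw [hρ, Equiv.swap_inv, hsy, inner_smul_right]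
  have hadj : ∀ d : ℤ, d * d = 1 → cellContent (p.1 i) = cellContent (p.1 j) + d → d = ε := by
    intro d hd hc
    have hd' : (d : ℂ) * d = 1 := by exact_mod_cast hd
    rw [swap_apply_of_adjacent hρ hij hu hd' (by simp [cont, hc]), inner_smul_left] at hinner
    have := mul_right_cancel₀ huy hinner
    simpa using this
  by_contra hneg
  have h1 : cellContent (p.1 i) ≠ cellContent (p.1 j) + 1 := fun hc => by
    have := hadj 1 (by norm_num) hc
    rw [hc, ← this] at hneg
    norm_num at hneg
  have h2 : cellContent (p.1 i) ≠ cellContent (p.1 j) - 1 := fun hc => by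
    have := hadj (-1) (by norm_num) (by rw [hc]; ring)
    rw [hc, ← this] at hneg
    norm_num at hneg
  have hsub : cont p.1 i - cont p.1 j ≠ 0 := by
    rw [sub_ne_zero]
    simpa [cont] using hne
  have hu' := swap_sub_mem_wt hij hu (inv_mul_cancel₀ hsub)
  rw [← cont_comp] at hu'
  have hlt : i ≠ j := fun hc => by rw [hc] at hij; omega
  have hq := hmin ⟨⟨_, p.2.swap_of_content hij h1 h2⟩, by rw [shape_comp_perm, hps], _, hu', by
    have hcast : cont p.1 i - cont p.1 j =
        ((cellContent (p.1 i) - cellContent (p.1 j) : ℤ) : ℂ) := by simp [cont]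
    rw [inner_sub_left, hinner, inner_smul_left, ← sub_mul, hcast]
    refine mul_ne_zero (fun hc => ?_) huy
    rw [map_inv₀, map_intCast] at hc
    have hm : (ε : ℂ) * ((cellContent (p.1 i) - cellContent (p.1 j) : ℤ) : ℂ) = 1 := by
      rw [sub_eq_zero.1 hc, inv_mul_cancel₀ (hcast ▸ hsub)]
    have hm' : ε * (cellContent (p.1 i) - cellContent (p.1 j)) = 1 := by exact_mod_cast hm
    rw [hm'] at hneg
    exact hneg one_pos⟩
  simp only [Function.comp_apply] at hq
  rw [← Finset.add_sum_erase _ _ (Finset.mem_univ i),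
    ← Finset.add_sum_erase _ _ (Finset.mem_erase.2 ⟨hlt.symm, Finset.mem_univ j⟩),
    ← Finset.add_sum_erase _ (fun i_1 : Fin n => (i_1.val : ℤ) *
      (ε * cellContent (p.1 (Equiv.swap i j i_1)))) (Finset.mem_univ i),
    ← Finset.add_sum_erase _ (fun i_1 : Fin n => (i_1.val : ℤ) *
      (ε * cellContent (p.1 (Equiv.swap i j i_1))))
      (Finset.mem_erase.2 ⟨hlt.symm, Finset.mem_univ j⟩), Equiv.swap_apply_left,
    Equiv.swap_apply_right] at hq
  have hE : ∑ k ∈ (Finset.univ.erase i).erase j,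
        (k.val : ℤ) * (ε * cellContent (p.1 (Equiv.swap i j k))) =
      ∑ k ∈ (Finset.univ.erase i).erase j, (k.val : ℤ) * (ε * cellContent (p.1 k)) :=
    Finset.sum_congr rfl fun k hk => by
      rw [Finset.mem_erase, Finset.mem_erase] at hk
      rw [Equiv.swap_apply_of_ne_of_ne hk.2.1 hk.1]
  have hj : (j.val : ℤ) = i.val + 1 := by omega
  rw [hj, hE] at hq
  have hz : ε * (cellContent (p.1 i) - cellContent (p.1 j)) ≠ 0 :=
    mul_ne_zero (by rintro rfl; simp at hε) (sub_ne_zero.2 hne)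
  have : ε * (cellContent (p.1 i) - cellContent (p.1 j)) < 0 :=
    lt_of_le_of_ne (not_lt.1 hneg) hz
  linarith

theorem exists_sorted (hρ : IsUnitaryRep ρ) {s : Finset (ℕ × ℕ)} {y : E}
    (hy : y ∈ blk ρ s) (hy0 : y ≠ 0) {r : Fin n → ℕ} (hr : Antitone r) {ε : ℤ} (hε : ε * ε = 1)
    (h : ∀ i j : Fin n, i.val + 1 = j.val → r i = r j → ρ (Equiv.swap i j) y = (ε : ℂ) • y) :
    ∃ p : Tab n, shape p.1 = s ∧ ∀ i j : Fin n, i < j → r i = r j →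
      0 < ε * (cellContent (p.1 i) - cellContent (p.1 j)) := by
  obtain ⟨p, hp, hadj⟩ := exists_sorted_adjacent hρ hy hy0 hε h
  refine ⟨p, hp, fun i ⟨j, hj⟩ hij hrij => ?_⟩
  induction j with
  | zero => exact absurd hij (by simp [Fin.lt_def])
  | succ j ih =>
    have hstep : (⟨j, by omega⟩ : Fin n) ≤ ⟨j + 1, hj⟩ := by simp
    have hle : i ≤ ⟨j, by omega⟩ := by
      rw [Fin.lt_def] at hij
      rw [Fin.le_def]
      simp only at hij ⊢
      omega
    have h1 : r ⟨j, by omega⟩ = r ⟨j + 1, hj⟩ :=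
      le_antisymm (by rw [← hrij]; exact hr hle) (hr hstep)
    have h2 := hadj ⟨j, by omega⟩ ⟨j + 1, hj⟩ rfl h1
    rcases hle.eq_or_lt with h3 | h3
    · rw [h3]; exact h2
    · have h4 := ih (by omega) h3 (by rw [hrij, h1])
      linarith

theorem card_le_of_injOn {r : ℕ → ℕ} {m b : ℕ} (h : ∀ a ≤ m, r a ≤ b)
    (hinj : ∀ a a', a < a' → a' ≤ m → r a ≠ r a') : m ≤ b := by
  have := Finset.card_le_card_of_injOn (s := Finset.range (m + 1)) (t := Finset.range (b + 1)) r
    (fun a ha => by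
      simp only [Finset.coe_range, Set.mem_Iio] at ha ⊢
      exact Nat.lt_succ_of_le (h a (by omega)))
    (fun a ha a' ha' heq => by
      simp only [Finset.coe_range, Set.mem_Iio] at ha ha'
      rcases lt_trichotomy a a' with hl | hl | hl
      · exact absurd heq (hinj a a' hl (by omega))
      · exact hl
      · exact absurd heq.symm (hinj a' a hl (by omega)))
  simpa using this

theorem IsStd.exists_of_le {p : Fin n → ℕ × ℕ} (hp : IsStd p) {i : Fin n} {x : ℕ × ℕ}
    (hx : x ≤ p i) : ∃ j, p j = x ∧ i ≤ j := by
  obtain ⟨j, rfl⟩ := hp.lower hx ⟨i, rfl⟩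
  exact ⟨j, rfl, hp.anti _ _ hx⟩

theorem snd_le_of_sorted {p : Fin n → ℕ × ℕ} (hp : IsStd p) {r : Fin n → ℕ} (hr : Antitone r)
    (h : ∀ i j : Fin n, i < j → r i = r j → cellContent (p j) < cellContent (p i)) (i : Fin n) :
    (p i).2 ≤ r i := by
  have hex : ∀ b, ∃ j, b ≤ (p i).2 → p j = ((p i).1, b) ∧ i ≤ j := fun b => by
    by_cases hb : b ≤ (p i).2
    · obtain ⟨j, hj⟩ := hp.exists_of_le (i := i) (x := ((p i).1, b)) ⟨le_rfl, hb⟩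
      exact ⟨j, fun _ => hj⟩
    · exact ⟨i, fun h => absurd h hb⟩
  choose f hf using hex
  refine card_le_of_injOn (r := r ∘ f) (fun b hb => hr (hf b hb).2) fun a b hab hb heq => ?_
  have ha' := (hf a (hab.le.trans hb)).1
  have hb' := (hf b hb).1
  have hlt : f b < f a := by
    refine lt_of_le_of_ne (hp.anti _ _ (by rw [ha', hb']; exact ⟨le_rfl, hab.le⟩)) fun hc => ?_
    rw [hc, ha'] at hb'
    simp at hb'
    omega
  have := h _ _ hlt heq.symm
  rw [ha', hb'] at this
  simp only [cellContent] at this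
  omega

theorem fst_le_of_sorted {p : Fin n → ℕ × ℕ} (hp : IsStd p) {r : Fin n → ℕ} (hr : Antitone r)
    (h : ∀ i j : Fin n, i < j → r i = r j → cellContent (p i) < cellContent (p j)) (i : Fin n) :
    (p i).1 ≤ r i := by
  have hex : ∀ b, ∃ j, b ≤ (p i).1 → p j = (b, (p i).2) ∧ i ≤ j := fun b => by
    by_cases hb : b ≤ (p i).1
    · obtain ⟨j, hj⟩ := hp.exists_of_le (i := i) (x := (b, (p i).2)) ⟨hb, le_rfl⟩
      exact ⟨j, fun _ => hj⟩
    · exact ⟨i, fun h => absurd h hb⟩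
  choose f hf using hex
  refine card_le_of_injOn (r := r ∘ f) (fun b hb => hr (hf b hb).2) fun a b hab hb heq => ?_
  have ha' := (hf a (hab.le.trans hb)).1
  have hb' := (hf b hb).1
  have hlt : f b < f a := by
    refine lt_of_le_of_ne (hp.anti _ _ (by rw [ha', hb']; exact ⟨hab.le, le_rfl⟩)) fun hc => ?_
    rw [hc, ha'] at hb'
    simp at hb'
    omega
  have := h _ _ hlt heq.symm
  rw [ha', hb'] at this
  simp only [cellContent] at this
  omega

theorem exists_snd_le (hρ : IsUnitaryRep ρ) {s : Finset (ℕ × ℕ)} {y : E}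
    (hy : y ∈ blk ρ s) (hy0 : y ≠ 0) {r : Fin n → ℕ} (hr : Antitone r)
    (h : ∀ i j : Fin n, i.val + 1 = j.val → r i = r j → ρ (Equiv.swap i j) y = y) :
    ∃ p : Tab n, shape p.1 = s ∧ ∀ i, (p.1 i).2 ≤ r i := by
  obtain ⟨p, hp, hs⟩ := exists_sorted hρ hy hy0 hr (ε := 1) (by norm_num)
    (fun i j hij hrij => by rw [h i j hij hrij]; simp)
  exact ⟨p, hp, snd_le_of_sorted p.2 hr fun i j hij hrij => by
    have := hs i j hij hrij; linarith⟩

theorem exists_fst_le (hρ : IsUnitaryRep ρ) {s : Finset (ℕ × ℕ)} {y : E}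
    (hy : y ∈ blk ρ s) (hy0 : y ≠ 0) {r : Fin n → ℕ} (hr : Antitone r)
    (h : ∀ i j : Fin n, i.val + 1 = j.val → r i = r j → ρ (Equiv.swap i j) y = -y) :
    ∃ p : Tab n, shape p.1 = s ∧ ∀ i, (p.1 i).1 ≤ r i := by
  obtain ⟨p, hp, hs⟩ := exists_sorted hρ hy hy0 hr (ε := -1) (by norm_num)
    (fun i j hij hrij => by rw [h i j hij hrij]; simp)
  exact ⟨p, hp, fst_le_of_sorted p.2 hr fun i j hij hrij => by
    have := hs i j hij hrij; linarith⟩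

end Blocks

/-- A standard shape is determined by a dominance condition on its rows and its columns. -/
theorem shape_eq_of_le {n : ℕ} {p q t : Tab n} (hpq : shape p.1 = shape q.1) (σ τ : Perm (Fin n))
    (h1 : ∀ i, (p.1 i).1 ≤ (t.1 (σ i)).1) (h2 : ∀ i, (q.1 i).2 ≤ (t.1 (τ i)).2) :
    shape p.1 = shape t.1 := by
  set μ : YoungDiagram := ⟨shape t.1, shape_lower t⟩ with hμ
  let h : ℕ × ℕ → ℤ := fun x => (x.2 : ℤ) - μ.rowLen x.1
  have hmem : ∀ x, x ∈ shape t.1 ↔ h x < 0 := fun x => by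
    change x ∈ μ ↔ _
    obtain ⟨i, j⟩ := x
    rw [YoungDiagram.mem_iff_lt_rowLen]
    simp only [h]
    omega
  have hsum : ∑ x ∈ shape p.1, h x ≤ ∑ x ∈ shape t.1, h x := by
    have e1 : ∑ x ∈ shape p.1, (x.2 : ℤ) ≤ ∑ x ∈ shape t.1, (x.2 : ℤ) := by
      rw [hpq, sum_shape, sum_shape, ← Equiv.sum_comp τ fun i => ((t.1 i).2 : ℤ)]
      exact Finset.sum_le_sum fun i _ => by exact_mod_cast h2 i
    have e2 : ∑ x ∈ shape t.1, (μ.rowLen x.1 : ℤ) ≤ ∑ x ∈ shape p.1, (μ.rowLen x.1 : ℤ) := by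
      rw [sum_shape p fun x => (μ.rowLen x.1 : ℤ), sum_shape t fun x => (μ.rowLen x.1 : ℤ),
        ← Equiv.sum_comp σ fun i => (μ.rowLen (t.1 i).1 : ℤ)]
      exact Finset.sum_le_sum fun i _ => by exact_mod_cast μ.rowLen_anti _ _ (h1 i)
    simp only [h, Finset.sum_sub_distrib]
    linarith
  have hd1 := Finset.sum_inter_add_sum_sdiff (shape p.1) (shape t.1) h
  have hd2 := Finset.sum_inter_add_sum_sdiff (shape t.1) (shape p.1) h
  rw [Finset.inter_comm] at hd2
  have hpos : 0 ≤ ∑ x ∈ shape p.1 \ shape t.1, h x := Finset.sum_nonneg fun x hx => by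
    rw [Finset.mem_sdiff, hmem] at hx
    exact not_lt.1 hx.2
  have hneg : ∑ x ∈ shape t.1 \ shape p.1, h x ≤ ∑ x ∈ shape t.1 \ shape p.1, (-1 : ℤ) :=
    Finset.sum_le_sum fun x hx => by
      rw [Finset.mem_sdiff, hmem] at hx
      linarith [hx.1]
  rw [Finset.sum_const, smul_neg, nsmul_one] at hneg
  have hcard : (shape t.1 \ shape p.1).card = 0 := by
    have : ((shape t.1 \ shape p.1).card : ℤ) ≤ 0 := by linarith
    omega
  rw [Finset.card_eq_zero, Finset.sdiff_eq_empty_iff_subset] at hcard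
  exact (Finset.eq_of_subset_of_card_le hcard (by rw [card_shape, card_shape])).symm

section Average

variable {n : ℕ} {E : Type*} [NormedAddCommGroup E] [InnerProductSpace ℂ E]

open Classical in
/-- The (twisted) average over the permutations preserving a labelling. -/
noncomputable def avg (ρ : Perm (Fin n) →* Module.End ℂ E) (χ : Perm (Fin n) →* ℤˣ)
    (r : Fin n → ℕ) : Module.End ℂ E :=
  ∑ g ∈ Finset.univ.filter fun g : Perm (Fin n) => r ∘ g = r, (((χ g : ℤˣ) : ℤ) : ℂ) • ρ g

variable {ρ : Perm (Fin n) →* Module.End ℂ E} {χ : Perm (Fin n) →* ℤˣ} {r : Fin n → ℕ}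

theorem map_avg {h : Perm (Fin n)} (hh : r ∘ h = r) (v : E) :
    ρ h (avg ρ χ r v) = (((χ h : ℤˣ) : ℤ) : ℂ) • avg ρ χ r v := by
  classical
  simp only [avg, LinearMap.sum_apply, map_sum, Finset.smul_sum]
  refine Finset.sum_bij' (fun g _ => h * g) (fun g _ => h⁻¹ * g) ?_ ?_ ?_ ?_ ?_
  · intro g hg
    simp only [Finset.mem_filter, Finset.mem_univ, true_and] at hg ⊢
    rw [Equiv.Perm.coe_mul, ← Function.comp_assoc, hh, hg]
  · intro g hg
    simp only [Finset.mem_filter, Finset.mem_univ, true_and] at hg ⊢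
    rw [Equiv.Perm.coe_mul, ← Function.comp_assoc]
    have : r ∘ ⇑h⁻¹ = r := by
      conv_lhs => rw [← hh, Function.comp_assoc, ← Equiv.Perm.coe_mul, mul_inv_cancel]
      rfl
    rw [this, hg]
  · simp
  · simp
  · intro g _
    have hu : (((χ h : ℤˣ) : ℤ) : ℂ) * (((χ h : ℤˣ) : ℤ) : ℂ) = 1 := by
      rw [← Int.cast_mul, ← Units.val_mul, Int.units_mul_self]
      simp
    simp only [LinearMap.smul_apply, map_smul, map_mul, Module.End.mul_apply, smul_smul,
      Units.val_mul, Int.cast_mul]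
    rw [← mul_assoc, hu, one_mul]

theorem avg_mem_blk (hρ : IsUnitaryRep ρ) {s : Finset (ℕ × ℕ)} {v : E} (hv : v ∈ blk ρ s) :
    avg ρ χ r v ∈ blk ρ s := by
  simp only [avg, LinearMap.sum_apply]
  exact Submodule.sum_mem _ fun g _ => Submodule.smul_mem _ _ (map_mem_blk hρ g hv)

theorem comp_swap_eq {i j : Fin n} (h : r i = r j) : r ∘ Equiv.swap i j = r := by
  ext k
  rw [Function.comp_apply, Equiv.swap_apply_def]
  split_ifs with h1 h2
  · rw [h1, h]
  · rw [h2, h]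
  · rfl

theorem wt_ne_bot_of_shape_eq (hρ : IsUnitaryRep ρ) {p q : Tab n} (hpq : shape p.1 = shape q.1)
    (h : wt ρ (cont q.1) ≠ ⊥) : wt ρ (cont p.1) ≠ ⊥ := by
  refine IsStd.connected (fun p => wt ρ (cont p) ≠ ⊥) (fun p _ hQ i j hij h1 h2 => ?_) p.2 q.2
    (by rw [← coe_shape, ← coe_shape, hpq]) h
  refine (isWeightSet hρ).swap (cont p) hQ i j hij (fun hc => h1 ?_) fun hc => h2 ?_
  · simp only [cont] at hc
    exact_mod_cast hc
  · simp only [cont] at hc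
    exact_mod_cast hc

theorem exists_perm_antitone (f : Fin n → ℕ) : ∃ σ : Perm (Fin n), Antitone (f ∘ σ) :=
  ⟨Tuple.sort (OrderDual.toDual ∘ f), fun _ _ h =>
    Tuple.monotone_sort (OrderDual.toDual ∘ f) h⟩

end Average

section Regular

variable {G : Type*} [Group G] [Fintype G]

/-- The left regular representation. -/
noncomputable def lreg (G : Type*) [Group G] [Fintype G] :
    G →* Module.End ℂ (EuclideanSpace ℂ G) where
  toFun g :=
    { toFun := fun v => WithLp.toLp 2 fun x => v (g⁻¹ * x)
      map_add' := fun _ _ => rfl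
      map_smul' := fun _ _ => rfl }
  map_one' := by ext; simp
  map_mul' g h := by
    ext v x
    change v _ = v _
    simp [mul_assoc]

/-- The right regular representation. -/
noncomputable def rreg (G : Type*) [Group G] [Fintype G] :
    G →* Module.End ℂ (EuclideanSpace ℂ G) where
  toFun g :=
    { toFun := fun v => WithLp.toLp 2 fun x => v (x * g)
      map_add' := fun _ _ => rfl
      map_smul' := fun _ _ => rfl }
  map_one' := by ext; simp
  map_mul' g h := by
    ext v x
    change v _ = v _
    simp [mul_assoc]

theorem lreg_apply (g : G) (v : EuclideanSpace ℂ G) (x : G) : lreg G g v x = v (g⁻¹ * x) := rfl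

theorem rreg_apply (g : G) (v : EuclideanSpace ℂ G) (x : G) : rreg G g v x = v (x * g) := rfl

theorem commute_lreg_rreg (g h : G) : Commute (lreg G g) (rreg G h) := by
  ext v x
  simp [lreg_apply, rreg_apply, mul_assoc]

variable {n : ℕ}

theorem isUnitaryRep_lreg : IsUnitaryRep (lreg (Perm (Fin n))) := by
  intro g x y
  simp only [PiLp.inner_apply, lreg_apply, inv_inv]
  rw [← Equiv.sum_comp (Equiv.mulLeft g)]
  simp

theorem isUnitaryRep_rreg : IsUnitaryRep (rreg (Perm (Fin n))) := by
  intro g x y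
  simp only [PiLp.inner_apply, rreg_apply]
  rw [← Equiv.sum_comp (Equiv.mulRight g) fun z => inner ℂ (x z) (y (z * g⁻¹))]
  simp

theorem youngSymmetrizer_ne_zero (t : Tab n) (σ τ : Perm (Fin n)) :
    avg (lreg (Perm (Fin n))) Equiv.Perm.sign ((fun i => (t.1 i).1) ∘ σ) *
      lreg (Perm (Fin n)) (σ⁻¹ * τ) *
      avg (lreg (Perm (Fin n))) 1 ((fun i => (t.1 i).2) ∘ τ) ≠ 0 := by
  classical
  intro h0
  have h := congrArg (fun x : EuclideanSpace ℂ (Perm (Fin n)) => x (σ⁻¹ * τ))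
    (LinearMap.congr_fun h0 (EuclideanSpace.single 1 1))
  simp only [avg, Module.End.mul_apply, LinearMap.sum_apply, LinearMap.smul_apply, map_sum,
    WithLp.ofLp_sum, Finset.sum_apply, PiLp.smul_apply, lreg_apply, LinearMap.zero_apply,
    PiLp.zero_apply, PiLp.single_apply, MonoidHom.one_apply, Units.val_one,
    Int.cast_one, one_smul] at h
  have key : ∀ g h : Perm (Fin n), ((fun i => (t.1 i).1) ∘ σ) ∘ g = (fun i => (t.1 i).1) ∘ σ →
      ((fun i => (t.1 i).2) ∘ τ) ∘ h = (fun i => (t.1 i).2) ∘ τ →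
      h⁻¹ * ((σ⁻¹ * τ)⁻¹ * (g⁻¹ * (σ⁻¹ * τ))) = 1 → h = 1 := by
    intro g h hg hh hgh
    have hg' : σ * g = τ * h⁻¹ * τ⁻¹ * σ := by
      rw [inv_mul_eq_one] at hgh
      rw [hgh]
      group
    have hk : ∀ i, t.1 (τ (h⁻¹ (τ⁻¹ i))) = t.1 i := by
      intro i
      refine Prod.ext ?_ ?_
      · have h1 := congrFun hg (σ⁻¹ i)
        have h2 := congrArg (fun x : Perm (Fin n) => x (σ⁻¹ i)) hg'
        have h3 : σ (σ⁻¹ i) = i := σ.apply_symm_apply i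
        simp only [Function.comp_apply, Equiv.Perm.mul_apply, h3] at h1 h2
        rw [h2] at h1
        exact h1
      · have h1 := congrFun hh (h⁻¹ (τ⁻¹ i))
        have h3 : h (h⁻¹ (τ⁻¹ i)) = τ⁻¹ i := h.apply_symm_apply _
        have h4 : τ (τ⁻¹ i) = i := τ.apply_symm_apply i
        simp only [Function.comp_apply, h3, h4] at h1
        exact h1.symm
    rw [← inv_inj, inv_one]
    ext i
    have := t.2.injective (hk (τ i))
    rw [show τ⁻¹ (τ i) = i from τ.symm_apply_apply i] at this
    rw [τ.injective this, Equiv.Perm.one_apply]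
  rw [Finset.sum_eq_single 1, Finset.sum_eq_single 1] at h
  · simp at h
  · intro g _ hg1
    rw [if_neg, smul_zero]
    intro hc
    rw [inv_one, one_mul, inv_mul_eq_one, right_eq_mul, inv_eq_one] at hc
    exact hg1 hc
  · intro hc
    simp at hc
  · intro x hx hx1
    refine Finset.sum_eq_zero fun g hg => ?_
    rw [if_neg, smul_zero]
    exact fun hgx => hx1 (key g x (Finset.mem_filter.1 hg).2 (Finset.mem_filter.1 hx).2 hgx)
  · intro hc
    simp at hc

theorem wt_lreg_ne_bot (t : Tab n) : wt (lreg (Perm (Fin n))) (cont t.1) ≠ ⊥ := by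
  obtain ⟨σ, hσ⟩ := exists_perm_antitone fun i => (t.1 i).1
  obtain ⟨τ, hτ⟩ := exists_perm_antitone fun i => (t.1 i).2
  have hT := youngSymmetrizer_ne_zero t σ τ
  have hρ := isUnitaryRep_lreg (n := n)
  set ρ := lreg (Perm (Fin n))
  set a := avg ρ Equiv.Perm.sign ((fun i => (t.1 i).1) ∘ σ) with ha
  set b := avg ρ 1 ((fun i => (t.1 i).2) ∘ τ) with hb
  obtain ⟨s, y, hys, hy⟩ : ∃ s, ∃ y ∈ blk ρ s, (a * ρ (σ⁻¹ * τ) * b) y ≠ 0 := by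
    by_contra! hcon
    refine hT (LinearMap.ker_eq_top.1 ?_)
    rw [eq_top_iff, ← iSup_blk hρ]
    exact iSup_le fun s y hy => hcon s y hy
  have hb0 : b y ≠ 0 := fun h => hy (by rw [Module.End.mul_apply, h, map_zero])
  have hbs : b y ∈ blk ρ s := avg_mem_blk hρ hys
  obtain ⟨q, hq, hq2⟩ := exists_snd_le hρ hbs hb0 hτ fun i j hij hr => by
    rw [hb, map_avg (comp_swap_eq hr)]
    simp
  obtain ⟨p, hp, hp1⟩ := exists_fst_le hρ (y := (a * ρ (σ⁻¹ * τ) * b) y)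
    (avg_mem_blk hρ (map_mem_blk hρ _ hbs)) hy hσ fun i j hij hr => by
      have hne : i ≠ j := fun h => by rw [h] at hij; omega
      rw [Module.End.mul_apply, Module.End.mul_apply, ha, map_avg (comp_swap_eq hr),
        Equiv.Perm.sign_swap hne]
      simp
  have hs : shape p.1 = shape t.1 := shape_eq_of_le (hp.trans hq.symm) σ τ hp1 hq2
  rw [hp] at hs
  subst hs
  have hex : ∃ q : {q : Tab n // shape q.1 = shape t.1}, wt ρ (cont q.1.1) ≠ ⊥ := by
    by_contra! hcon
    have : b y ∈ (⊥ : Submodule ℂ _) := by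
      rw [← iSup_eq_bot.2 hcon]
      exact hbs
    exact hb0 this
  obtain ⟨q', hq'⟩ := hex
  exact wt_ne_bot_of_shape_eq hρ q'.2.symm hq'

end Regular

theorem cont_injective {n : ℕ} {p q : Tab n} (h : cont p.1 = cont q.1) : p = q :=
  Subtype.ext (p.2.eq_of_content q.2 fun i => by
    have := congrFun h i
    simp only [cont] at this
    exact_mod_cast this)

section Commuting

variable {n : ℕ} {E : Type*} [NormedAddCommGroup E] [InnerProductSpace ℂ E]
  {ρ : Perm (Fin n) →* Module.End ℂ E}

theorem eq_zero_of_sum_eq_zero (hρ : IsUnitaryRep ρ) (x : Tab n → E)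
    (hx : ∀ p, x p ∈ wt ρ (cont p.1)) (h : ∑ p, x p = 0) (p : Tab n) : x p = 0 := by
  have h1 : inner ℂ (x p) (∑ q, x q) = 0 := by rw [h, inner_zero_right]
  rw [inner_sum, Finset.sum_eq_single p (fun q _ hq => inner_eq_zero_of_mem_wt hρ
    (fun hc => hq (cont_injective hc).symm) (hx p) (hx q)) (by simp)] at h1
  exact inner_self_eq_zero.1 h1

theorem exists_sum_eq [FiniteDimensional ℂ E] (hρ : IsUnitaryRep ρ) (v : E) :
    ∃ x : Tab n → E, (∀ p, x p ∈ wt ρ (cont p.1)) ∧ ∑ p, x p = v := by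
  have hv : v ∈ ⨆ p : Tab n, wt ρ (cont p.1) := by rw [iSup_wt hρ]; trivial
  rw [Submodule.mem_iSup_iff_exists_finsupp] at hv
  obtain ⟨f, hf, rfl⟩ := hv
  exact ⟨f, hf, (Finsupp.sum_fintype f (fun _ x => x) fun _ => rfl).symm⟩

theorem map_mem_wt {T : Module.End ℂ E} (hT : ∀ g, Commute T (ρ g)) {α : Fin n → ℂ} {v : E}
    (hv : v ∈ wt ρ α) : T v ∈ wt ρ α := by
  rw [mem_wt] at hv ⊢
  intro i
  have hc : Commute T (jm ρ i) := Commute.sum_right _ _ _ fun j _ => hT _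
  rw [show jm ρ i (T v) = T (jm ρ i v) from (LinearMap.congr_fun hc.eq v).symm, hv, map_smul]

end Commuting

section BiWeight

variable {n : ℕ}

local notation "L" => lreg (Perm (Fin n))
local notation "R" => rreg (Perm (Fin n))

theorem jm_apply_single (i : Fin n) :
    jm R i (EuclideanSpace.single 1 1) = jm L i (EuclideanSpace.single 1 1) := by
  classical
  simp only [jm, LinearMap.sum_apply]
  refine Finset.sum_congr rfl fun j _ => ?_
  ext x
  rw [rreg_apply, lreg_apply, PiLp.single_apply, PiLp.single_apply]
  refine if_congr ?_ rfl rfl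
  rw [inv_mul_eq_one, mul_eq_one_iff_eq_inv, Equiv.swap_inv, eq_comm]

theorem exists_diagonal_ne_zero (p : Tab n) : ∃ u ∈ wt L (cont p.1) ⊓ wt R (cont p.1), u ≠ 0 := by
  classical
  obtain ⟨x, hx, hsum⟩ := exists_sum_eq isUnitaryRep_lreg
    (EuclideanSpace.single (1 : Perm (Fin n)) (1 : ℂ))
  have hcomm : ∀ g h, Commute (R g) (L h) := fun g h => (commute_lreg_rreg h g).symm
  refine ⟨x p, ⟨hx p, mem_wt.2 fun i => ?_⟩, fun h0 => ?_⟩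
  · rw [← sub_eq_zero]
    have hjm : ∀ g, Commute (jm R i) (L g) := fun g => Commute.sum_left _ _ _ fun j _ => hcomm _ _
    refine eq_zero_of_sum_eq_zero isUnitaryRep_lreg
      (fun q => jm R i (x q) - cont q.1 i • x q)
      (fun q => Submodule.sub_mem _ (map_mem_wt hjm (hx q)) (Submodule.smul_mem _ _ (hx q))) ?_ p
    rw [Finset.sum_sub_distrib, ← map_sum, hsum, jm_apply_single, ← hsum, map_sum, sub_eq_zero]
    exact Finset.sum_congr rfl fun q _ => mem_wt.1 (hx q) i
  · obtain ⟨v, hv, hv0⟩ := Submodule.exists_mem_ne_zero_of_ne_bot (wt_lreg_ne_bot p)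
    refine hv0 ?_
    ext g
    have h1 : inner ℂ (EuclideanSpace.single (1 : Perm (Fin n)) (1 : ℂ)) (R g v) = 0 := by
      rw [← hsum, sum_inner]
      refine Finset.sum_eq_zero fun q _ => ?_
      by_cases hq : q = p
      · rw [hq, h0, inner_zero_left]
      · exact inner_eq_zero_of_mem_wt isUnitaryRep_lreg (fun hc => hq (cont_injective hc)) (hx q)
          (map_mem_wt (hcomm g) hv)
    rw [EuclideanSpace.inner_single_left, rreg_apply] at h1
    simpa using h1

theorem exists_biweight (p q : Tab n) (h : shape p.1 = shape q.1) :
    ∃ u ∈ wt L (cont p.1) ⊓ wt R (cont q.1), u ≠ 0 := by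
  refine IsStd.connected (fun q => ∃ u ∈ wt L (cont p.1) ⊓ wt R (cont q), u ≠ 0)
    (fun q hq hQ i j hij h1 h2 => ?_) q.2 p.2 (by rw [← coe_shape, ← coe_shape, h])
    (exists_diagonal_ne_zero p)
  obtain ⟨u, ⟨huL, huR⟩, hu0⟩ := hQ
  have hne : cont q i - cont q j ≠ 0 := by
    rw [sub_ne_zero]
    simpa [cont] using hq.content_ne hij
  refine ⟨R (Equiv.swap i j) u - (cont q i - cont q j)⁻¹ • u, ⟨?_, ?_⟩, ?_⟩
  · exact Submodule.sub_mem _ (map_mem_wt (fun g => (commute_lreg_rreg g _).symm) huL)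
      (Submodule.smul_mem _ _ huL)
  · rw [cont_comp]
    exact swap_sub_mem_wt hij huR (inv_mul_cancel₀ hne)
  · refine swap_sub_ne_zero hu0 (fun hc => h1 ?_) (fun hc => h2 ?_) (inv_mul_cancel₀ hne)
    · simp only [cont] at hc
      exact_mod_cast hc
    · simp only [cont] at hc
      exact_mod_cast hc

instance (n : ℕ) : Nonempty (TabPair n) := by
  rw [← Fintype.card_pos_iff, card_tabPair]
  exact n.factorial_pos

theorem exists_basis : ∃ b : Module.Basis (TabPair n) ℂ (EuclideanSpace ℂ (Perm (Fin n))),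
    ∀ t i, jm L i (b t) = cont t.1.1.1 i • b t := by
  classical
  choose u hu hu0 using fun t : TabPair n => exists_biweight t.1.1 t.1.2 t.2
  have hli : LinearIndependent ℂ u := by
    refine linearIndependent_of_ne_zero_of_inner_eq_zero hu0 fun s t hst => ?_
    by_cases h : s.1.1 = t.1.1
    · exact inner_eq_zero_of_mem_wt isUnitaryRep_rreg
        (fun hc => hst (Subtype.ext (Prod.ext h (cont_injective hc)))) (hu s).2 (hu t).2
    · exact inner_eq_zero_of_mem_wt isUnitaryRep_lreg (fun hc => h (cont_injective hc))
        (hu s).1 (hu t).1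
  refine ⟨basisOfLinearIndependentOfCardEqFinrank hli ?_, fun t i => ?_⟩
  · rw [card_tabPair, finrank_euclideanSpace, Fintype.card_perm, Fintype.card_fin]
  · rw [coe_basisOfLinearIndependentOfCardEqFinrank]
    exact mem_wt.1 (hu t).1 i

end BiWeight

theorem toMatrix_jm_zero (m : ℕ) :
    LinearMap.toMatrix (EuclideanSpace.basisFun (Perm (Fin (m + 1))) ℂ).toBasis
      (EuclideanSpace.basisFun (Perm (Fin (m + 1))) ℂ).toBasis
      (jm (lreg (Perm (Fin (m + 1)))) 0) = adjMatn (m + 1) := by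
  classical
  ext σ τ
  rw [LinearMap.toMatrix_apply, OrthonormalBasis.coe_toBasis, EuclideanSpace.basisFun_apply,
    OrthonormalBasis.coe_toBasis_repr_apply, EuclideanSpace.basisFun_repr]
  simp only [jm, LinearMap.sum_apply, WithLp.ofLp_sum, Finset.sum_apply, lreg_apply,
    PiLp.single_apply, adjMatn, Equiv.swap_inv]
  split_ifs with h
  · obtain ⟨i, hi, h⟩ := h
    have hτ : τ = Equiv.swap 0 i * σ := by rw [← h]; group
    rw [Finset.sum_eq_single i]
    · rw [if_pos hτ.symm]
    · intro j hj hji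
      rw [if_neg]
      intro hc
      rw [hτ, mul_left_inj] at hc
      have := congrArg (fun g : Perm (Fin (m + 1)) => g 0) hc
      simp only [Equiv.swap_apply_left] at this
      exact hji this
    · intro hc
      rw [Finset.mem_Ioi] at hc
      exact absurd (Fin.pos_iff_ne_zero.2 hi) hc
  · refine Finset.sum_eq_zero fun i hi => ?_
    rw [if_neg]
    intro hc
    rw [Finset.mem_Ioi] at hi
    exact h ⟨i, hi.ne', by rw [← hc]; group⟩

theorem charpoly_adjMatn (m : ℕ) : (adjMatn (m + 1)).charpoly =
    ∏ t : TabPair (m + 1), (X - C (cellContent (t.1.1.1 0) : ℂ)) := by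
  classical
  obtain ⟨b, hb⟩ := exists_basis (n := m + 1)
  rw [← toMatrix_jm_zero, LinearMap.charpoly_toMatrix,
    ← LinearMap.charpoly_toMatrix (jm (lreg (Perm (Fin (m + 1)))) 0) b]
  have hd : LinearMap.toMatrix b b (jm (lreg (Perm (Fin (m + 1)))) 0) =
      Matrix.diagonal fun t => (cellContent (t.1.1.1 0) : ℂ) := by
    ext s t
    rw [LinearMap.toMatrix_apply, hb, map_smul, Module.Basis.repr_self, Matrix.diagonal_apply]
    by_cases h : s = t
    · subst h
      simp [cont]
    · simp [h]
  rw [hd, Matrix.charpoly_diagonal]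

theorem count_roots_adjMatn (m : ℕ) (k : ℤ) :
    (adjMatn (m + 1)).charpoly.roots.count (k : ℂ) =
      Nat.card {t : TabPair (m + 1) // cellContent (t.1.1.1 0) = k} := by
  classical
  rw [charpoly_adjMatn, Polynomial.roots_prod _ _
    (Finset.prod_ne_zero_iff.2 fun t _ => X_sub_C_ne_zero _), Multiset.count_bind]
  simp only [roots_X_sub_C, Multiset.count_singleton, Int.cast_inj]
  rw [Nat.card_eq_fintype_card, Fintype.card_subtype, Finset.card_filter]
  change ∑ t, _ = _
  simp only [eq_comm]

theorem entry_injective {μ : YoungDiagram} : Function.Injective (SYT.entry (μ := μ)) := by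
  rintro ⟨e, _, _, _, _⟩ ⟨e', _, _, _, _⟩ h
  simp only at h
  subst h
  rfl

theorem entry_mono {μ : YoungDiagram} (T : SYT μ) {x y : ℕ × ℕ} (hy : y ∈ μ) (hxy : x ≤ y) :
    T.entry x ≤ T.entry y := by
  obtain ⟨a, b⟩ := x
  obtain ⟨c, d⟩ := y
  obtain ⟨h1, h2⟩ := Prod.mk_le_mk.1 hxy
  have e1 : T.entry (a, b) ≤ T.entry (a, d) := by
    rcases h2.eq_or_lt with rfl | h2
    · exact le_rfl
    · exact (T.row_strict a b d h2 (μ.up_left_mem h1 le_rfl hy)).le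
  refine e1.trans ?_
  rcases h1.eq_or_lt with rfl | h1
  · exact le_rfl
  · exact (T.col_strict a c d h1 hy).le

theorem exists_cell {n : ℕ} {μ : YoungDiagram} (hμ : μ.card = n) (T : SYT μ) (i : Fin n) :
    ∃ c ∈ μ.cells, T.entry c = n - i.val := by
  obtain ⟨c, hc, h⟩ := T.bijOn'.surjOn (show n - i.val ∈ Set.Icc 1 μ.card by
    rw [Set.mem_Icc]
    omega)
  exact ⟨c, hc, h⟩

/-- The cells of a tableau in decreasing order of their entries. -/
noncomputable def cellsOf {n : ℕ} {μ : YoungDiagram} (hμ : μ.card = n) (T : SYT μ) (i : Fin n) :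
    ℕ × ℕ :=
  (exists_cell hμ T i).choose

section Cells

variable {n : ℕ} {μ : YoungDiagram} (hμ : μ.card = n) (T : SYT μ)

theorem cellsOf_mem (i : Fin n) : cellsOf hμ T i ∈ μ.cells := (exists_cell hμ T i).choose_spec.1

theorem entry_cellsOf (i : Fin n) : T.entry (cellsOf hμ T i) = n - i.val :=
  (exists_cell hμ T i).choose_spec.2

theorem exists_cellsOf_eq {c : ℕ × ℕ} (hc : c ∈ μ.cells) : ∃ i, cellsOf hμ T i = c := by
  have h := T.bijOn'.mapsTo hc
  rw [Set.mem_Icc] at h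
  refine ⟨⟨n - T.entry c, by omega⟩, T.bijOn'.injOn (cellsOf_mem hμ T _) hc ?_⟩
  rw [entry_cellsOf]
  simp only
  omega

theorem range_cellsOf : Set.range (cellsOf hμ T) = (μ.cells : Set (ℕ × ℕ)) := by
  ext c
  constructor
  · rintro ⟨i, rfl⟩
    exact cellsOf_mem hμ T i
  · exact fun hc => exists_cellsOf_eq hμ T hc

theorem isStd_cellsOf : IsStd (cellsOf hμ T) where
  lower := by rw [range_cellsOf]; exact μ.isLowerSet
  anti i j h := by
    have := entry_mono T (cellsOf_mem hμ T j) h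
    rw [entry_cellsOf, entry_cellsOf] at this
    rw [Fin.le_def]
    omega

theorem shape_cellsOf : shape (cellsOf hμ T) = μ.cells := by
  rw [← Finset.coe_inj, coe_shape, range_cellsOf]

theorem cellsOf_injective : Function.Injective (cellsOf hμ) := by
  intro T T' h
  refine entry_injective (funext fun c => ?_)
  by_cases hc : c ∈ μ.cells
  · obtain ⟨i, rfl⟩ := exists_cellsOf_eq hμ T hc
    rw [entry_cellsOf, h, entry_cellsOf]
  · rw [T.zeros' c hc, T'.zeros' c hc]

theorem exists_cellsOf (p : Tab n) (hp : shape p.1 = μ.cells) : ∃ T : SYT μ, cellsOf hμ T = p.1 := by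
  classical
  let e : ℕ × ℕ → ℕ := fun c => if h : ∃ i, p.1 i = c then n - h.choose.val else 0
  have he : ∀ i, e (p.1 i) = n - i.val := fun i => by
    have h : ∃ j, p.1 j = p.1 i := ⟨i, rfl⟩
    simp only [e, dif_pos h]
    rw [p.2.injective h.choose_spec]
  have hrange : ∀ c, c ∈ μ.cells ↔ ∃ i, p.1 i = c := fun c => by
    rw [← hp, ← Finset.mem_coe, coe_shape, Set.mem_range]
  have hlt : ∀ x y, x < y → y ∈ μ → e x < e y := by
    intro x y hxy hy
    obtain ⟨i, rfl⟩ := (hrange x).1 (μ.isLowerSet hxy.le hy)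
    obtain ⟨j, rfl⟩ := (hrange y).1 hy
    have h1 := p.2.anti i j hxy.le
    have h2 : j ≠ i := fun h => hxy.ne (by rw [h])
    have h3 := lt_of_le_of_ne h1 h2
    rw [Fin.lt_def] at h3
    rw [he, he]
    omega
  let T : SYT μ :=
    { entry := e
      zeros' := fun c hc => dif_neg fun h => hc ((hrange c).2 h)
      bijOn' := by
        refine ⟨fun c hc => ?_, fun c hc d hd h => ?_, fun a ha => ?_⟩
        · obtain ⟨i, rfl⟩ := (hrange c).1 hc
          rw [he, Set.mem_Icc]
          omega
        · obtain ⟨i, rfl⟩ := (hrange c).1 hc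
          obtain ⟨j, rfl⟩ := (hrange d).1 hd
          rw [he, he] at h
          rw [show i = j from Fin.ext (by omega)]
        · rw [Set.mem_Icc] at ha
          refine ⟨p.1 ⟨n - a, by omega⟩, (hrange _).2 ⟨_, rfl⟩, ?_⟩
          rw [he]
          simp only
          omega
      row_strict := fun i j1 j2 h hmem => hlt _ _ (Prod.mk_lt_mk_iff_right.2 h) hmem
      col_strict := fun i1 i2 j h hmem => hlt _ _ (Prod.mk_lt_mk_iff_left.2 h) hmem }
  refine ⟨T, funext fun i => T.bijOn'.injOn (cellsOf_mem hμ T i) ((hrange _).2 ⟨i, rfl⟩) ?_⟩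
  rw [entry_cellsOf]
  exact (he i).symm

end Cells

theorem exists_content_iff {m : ℕ} {μ : YoungDiagram} (hμ : μ.card = m + 1) (T : SYT μ) (k : ℤ) :
    (∃ c ∈ μ.cells, T.entry c = m + 1 ∧ cellContent c = k) ↔
      cellContent (cellsOf hμ T 0) = k := by
  constructor
  · rintro ⟨c, hc, h1, h2⟩
    rw [← h2, T.bijOn'.injOn hc (cellsOf_mem hμ T 0) (by rw [h1, entry_cellsOf]; rfl)]
  · exact fun h => ⟨_, cellsOf_mem hμ T 0, entry_cellsOf hμ T 0, h⟩

theorem card_pairs (m : ℕ) (k : ℤ) :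
    Nat.card (Σ μ : {μ : YoungDiagram // μ.card = m + 1},
        {T : SYT μ.1 // ∃ c ∈ μ.1.cells, T.entry c = m + 1 ∧ cellContent c = k} × SYT μ.1) =
      Nat.card {t : TabPair (m + 1) // cellContent (t.1.1.1 0) = k} := by
  refine Nat.card_eq_of_bijective (fun x => ⟨⟨(⟨_, isStd_cellsOf x.1.2 x.2.1.1⟩,
    ⟨_, isStd_cellsOf x.1.2 x.2.2⟩), by rw [shape_cellsOf, shape_cellsOf]⟩,
    (exists_content_iff x.1.2 x.2.1.1 k).1 x.2.1.2⟩) ⟨?_, ?_⟩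
  · rintro ⟨⟨μ, hμ⟩, ⟨T, hT⟩, T'⟩ ⟨⟨ν, hν⟩, ⟨S, hS⟩, S'⟩ h
    simp only [Subtype.mk.injEq, Prod.mk.injEq] at h
    obtain ⟨h1, h2⟩ := h
    have hμν : μ = ν := YoungDiagram.ext (by
      rw [← shape_cellsOf hμ T, ← shape_cellsOf hν S, h1])
    subst hμν
    obtain rfl := cellsOf_injective hμ h1
    obtain rfl := cellsOf_injective hμ h2
    rfl
  · rintro ⟨⟨⟨p, q⟩, hpq⟩, hk⟩
    let μ : YoungDiagram := ⟨shape p.1, shape_lower p⟩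
    have hμ : μ.card = m + 1 := card_shape p
    obtain ⟨T, hT⟩ := exists_cellsOf hμ p rfl
    obtain ⟨S, hS⟩ := exists_cellsOf hμ q hpq.symm
    refine ⟨⟨⟨μ, hμ⟩, ⟨T, (exists_content_iff hμ T k).2 (by rw [hT]; exact hk)⟩, S⟩, ?_⟩
    exact Subtype.ext (Subtype.ext (Prod.ext (Subtype.ext hT) (Subtype.ext hS)))

end StarCayley

/-- The multiplicity of `k ∈ ℤ` as an eigenvalue of the adjacency matrix of `G_n`
(i.e. as a root of its characteristic polynomial) equals the number of ordered pairs
`(T, T')` of standard Young tableaux of the same shape `λ ⊢ n` such that in `T` the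
entry `n` occupies a box of content `k`; equivalently it equals
`Σ_{λ ⊢ n} f_λ · I_λ(k)`. -/
theorem cayley_multiplicity_eq_tableaux_count (n : ℕ) (hn : 2 ≤ n) (k : ℤ) :
    ((adjMatn n).charpoly.roots).count (k : ℂ) =
      Nat.card (Σ μ : {μ : YoungDiagram // μ.card = n},
        {T : SYT μ.1 // ∃ c ∈ μ.1.cells, T.entry c = n ∧ cellContent c = k} × SYT μ.1) := by
  obtain ⟨m, rfl⟩ : ∃ m, n = m + 1 := ⟨n - 1, by omega⟩
  rw [StarCayley.card_pairs, StarCayley.count_roots_adjMatn]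
end

section
/- Let G_n be the Cayley graph of 𝔖_n generated by the transpositions (1 i), 2 ≤ i ≤ n. For n > 3, the set of eigenvalues of the adjacency matrix of G_n is exactly {−(n−1), −(n−2), …, n−2, n−1}; in particular 0 is an eigenvalue. For n ∈ {2,3}, the set of eigenvalues is exactly {−(n−1), …, n−1} \ {0}. -/
open Equiv Polynomial

section JucysMurphy

variable {α : Type*} [DecidableEq α]

/-- Jucys–Murphy elements commute: the star `∑ i ∈ T, (i q)` commutes with the star at `p`
over `T ∪ {q}`. -/
theorem commute_sum_swap {R : Type*} [Ring R] (ρ : Perm α →* R) {T : Finset α} {p q : α}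
    (hp : p ∉ T) (hq : q ∉ T) (hpq : p ≠ q) :
    Commute (∑ i ∈ T, ρ (swap i q)) (∑ j ∈ insert q T, ρ (swap j p)) := by
  refine Commute.sum_left _ _ _ fun i hi => ?_
  have hip : i ≠ p := fun h => hp (h ▸ hi)
  have hiq : i ≠ q := fun h => hq (h ▸ hi)
  rw [Finset.sum_insert hq, ← Finset.add_sum_erase _ _ hi, ← add_assoc]
  refine Commute.add_right ?_ (Commute.sum_right _ _ _ fun j hj => ?_)
  · have h₁ : swap i q * swap q p = swap i p * swap i q := by
      ext x; simp only [Perm.mul_apply, swap_apply_def]; grind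
    have h₂ : swap i q * swap i p = swap q p * swap i q := by
      ext x; simp only [Perm.mul_apply, swap_apply_def]; grind
    simp only [Commute, SemiconjBy, mul_add, add_mul, ← map_mul, h₁, h₂, add_comm]
  · have hj' := Finset.mem_erase.1 hj
    have hjp : j ≠ p := fun h => hp (h ▸ hj'.2)
    have hjq : j ≠ q := fun h => hq (h ▸ hj'.2)
    have h : swap i q * swap j p = swap j p * swap i q := by
      ext x; simp only [Perm.mul_apply, swap_apply_def]; grind
    simp only [Commute, SemiconjBy, ← map_mul, h]

/-- Commuting operators have a common eigenvector inside each eigenspace of one of them. -/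
theorem exists_common_eigenvector {V : Type*} [AddCommGroup V] [Module ℂ V]
    [FiniteDimensional ℂ V] {X Y : Module.End ℂ V} (hXY : Commute X Y) {b : ℂ} {w : V}
    (hw : w ≠ 0) (hb : Y w = b • w) :
    ∃ (a : ℂ) (v : V), v ≠ 0 ∧ X v = a • v ∧ Y v = b • v := by
  have hmaps : ∀ v ∈ Y.eigenspace b, X v ∈ Y.eigenspace b := fun v hv => by
    rw [Module.End.mem_eigenspace_iff] at hv ⊢
    rw [← Module.End.mul_apply, ← hXY.eq, Module.End.mul_apply, hv, map_smul]
  have : Nontrivial (Y.eigenspace b) :=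
    ⟨⟨⟨w, Module.End.mem_eigenspace_iff.2 hb⟩, 0, fun h => hw (congrArg Subtype.val h)⟩⟩
  obtain ⟨a, ha⟩ := Module.End.exists_eigenvalue (X.restrict hmaps)
  obtain ⟨v, hv⟩ := ha.exists_hasEigenvector
  refine ⟨a, v, fun h => hv.2 (Subtype.ext h), congrArg Subtype.val hv.apply_eq_smul,
    Module.End.mem_eigenspace_iff.1 v.2⟩

/-- In a finite-dimensional representation of a symmetric group, the eigenvalues of a star of
`k` transpositions are integers of absolute value at most `k`. -/
theorem eigenvalue_sum_swap {V : Type*} [AddCommGroup V] [Module ℂ V] [FiniteDimensional ℂ V]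
    (ρ : Perm α →* Module.End ℂ V) (S : Finset α) :
    ∀ (p : α) (b : ℂ) (w : V), p ∉ S → w ≠ 0 → (∑ i ∈ S, ρ (swap i p)) w = b • w →
      ∃ k : ℤ, -(S.card : ℤ) ≤ k ∧ k ≤ S.card ∧ b = k := by
  induction S using Finset.induction_on with
  | empty =>
    intro p b w _ hw hb
    refine ⟨0, by simp, by simp, ?_⟩
    simpa [hw, eq_comm] using hb
  | insert q T hq ih =>
    intro p b w hp hw hb
    have hpq : p ≠ q := fun h => hp (h ▸ Finset.mem_insert_self _ _)
    have hpT : p ∉ T := fun h => hp (Finset.mem_insert_of_mem h)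
    obtain ⟨a, v, hv, ha, hb⟩ :=
      exists_common_eigenvector (commute_sum_swap ρ hpT hq hpq) hw hb
    have hss : ρ (swap q p) * ρ (swap q p) = 1 := by rw [← map_mul, swap_mul_self, map_one]
    have hrel : (∑ i ∈ T, ρ (swap i q)) * ρ (swap q p) + 1 =
        ρ (swap q p) * ∑ j ∈ insert q T, ρ (swap j p) := by
      rw [Finset.sum_insert hq, mul_add, hss, add_comm, Finset.sum_mul, Finset.mul_sum]
      refine congrArg _ (Finset.sum_congr rfl fun i hi => ?_)
      have hip : i ≠ p := fun h => hpT (h ▸ hi)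
      have hiq : i ≠ q := fun h => hq (h ▸ hi)
      rw [← map_mul, ← map_mul]
      congr 1
      ext x; simp only [Perm.mul_apply, swap_apply_def]; grind
    have hsv := congrArg (fun f : Module.End ℂ V => f v) hrel
    have hssv := congrArg (fun f : Module.End ℂ V => f v) hss
    simp only [LinearMap.add_apply, Module.End.mul_apply, Module.End.one_apply, hb,
      map_smul] at hsv hssv
    rw [← eq_sub_iff_add_eq] at hsv
    rw [Finset.card_insert_of_notMem hq]
    push_cast
    by_cases hu : v + (a - b) • ρ (swap q p) v = 0
    · have hu' := congrArg (ρ (swap q p)) hu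
      simp only [map_add, map_smul, hssv, map_zero] at hu'
      have hsq : (1 - (a - b) ^ 2) • v = 0 := by
        have : (1 - (a - b) ^ 2) • v = (v + (a - b) • ρ (swap q p) v) -
            (a - b) • (ρ (swap q p) v + (a - b) • v) := by module
        rw [this, hu, hu', smul_zero, sub_zero]
      have hab : (a - b - 1) * (a - b + 1) = 0 := by
        linear_combination -(smul_eq_zero.1 hsq).resolve_right hv
      obtain ⟨k, hk₁, hk₂, rfl⟩ := ih q a v hq hv ha
      rcases mul_eq_zero.1 hab with h | h
      · exact ⟨k - 1, by omega, by omega, by push_cast; linear_combination -h⟩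
      · exact ⟨k + 1, by omega, by omega, by push_cast; linear_combination -h⟩
    · obtain ⟨k, hk₁, hk₂, rfl⟩ := ih q b _ hq hu (by
        rw [map_add, map_smul, ha, hsv]; module)
      exact ⟨k, by omega, by omega, rfl⟩

end JucysMurphy

theorem adjMatn_mulVec (N : ℕ) (f : Perm (Fin (N + 1)) → ℂ) (σ : Perm (Fin (N + 1))) :
    (adjMatn (N + 1)).mulVec f σ = ∑ i ∈ Finset.univ.erase 0, f (swap 0 i * σ) := by
  simp only [Matrix.mulVec, dotProduct, adjMatn, ite_mul, one_mul, zero_mul]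
  rw [← Finset.sum_filter]
  symm
  refine Finset.sum_bij (fun i _ => swap 0 i * σ) ?_ ?_ ?_ ?_
  · intro i hi
    simpa using ⟨i, (Finset.mem_erase.1 hi).1, rfl⟩
  · intro i _ j _ hij
    simpa using congrArg (fun τ : Perm (Fin (N + 1)) => τ 0) (mul_right_cancel hij)
  · intro τ hτ
    obtain ⟨i, hi, h⟩ := (Finset.mem_filter.1 hτ).2
    exact ⟨i, by simpa using hi, by rw [← h, inv_mul_cancel_right]⟩
  · intro i _
    rfl

theorem mem_roots_charpoly_adjMatn {N : ℕ} {μ : ℂ} :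
    μ ∈ (adjMatn (N + 1)).charpoly.roots ↔
      ∃ f : Perm (Fin (N + 1)) → ℂ, f ≠ 0 ∧
        ∀ σ, ∑ i ∈ Finset.univ.erase 0, f (swap 0 i * σ) = μ * f σ := by
  rw [mem_roots (Matrix.charpoly_monic _).ne_zero, IsRoot.def, Matrix.eval_charpoly,
    ← Matrix.exists_mulVec_eq_zero_iff]
  refine exists_congr fun f => and_congr_right fun _ => ?_
  rw [Matrix.sub_mulVec, sub_eq_zero, eq_comm, funext_iff]
  refine forall_congr' fun σ => ?_
  rw [adjMatn_mulVec, Matrix.scalar_apply, Matrix.mulVec_diagonal]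

theorem exists_int_of_mem_roots_adjMatn {N : ℕ} {μ : ℂ}
    (hμ : μ ∈ (adjMatn (N + 1)).charpoly.roots) :
    ∃ k : ℤ, -(N : ℤ) ≤ k ∧ k ≤ N ∧ μ = k := by
  obtain ⟨f, hf, h⟩ := mem_roots_charpoly_adjMatn.1 hμ
  let ρ : Perm (Fin (N + 1)) →* Module.End ℂ (Perm (Fin (N + 1)) → ℂ) :=
    { toFun := fun g => LinearMap.funLeft ℂ ℂ fun σ => g⁻¹ * σ
      map_one' := by ext; simp [LinearMap.funLeft]
      map_mul' := fun g h => by ext; simp [LinearMap.funLeft, Function.comp_def, mul_assoc] }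
  have := eigenvalue_sum_swap ρ (Finset.univ.erase 0) 0 μ f (by simp) hf (by
    ext σ
    rw [LinearMap.sum_apply, Finset.sum_apply, Pi.smul_apply, smul_eq_mul, ← h]
    refine Finset.sum_congr rfl fun i _ => ?_
    simp [ρ, LinearMap.funLeft_apply, swap_comm])
  simpa using this

/-- Twisting by the sign character. -/
theorem neg_mem_roots_charpoly_adjMatn {N : ℕ} {μ : ℂ}
    (hμ : μ ∈ (adjMatn (N + 1)).charpoly.roots) : -μ ∈ (adjMatn (N + 1)).charpoly.roots := by
  obtain ⟨f, hf, h⟩ := mem_roots_charpoly_adjMatn.1 hμ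
  refine mem_roots_charpoly_adjMatn.2 ⟨fun σ => ((Perm.sign σ : ℤ) : ℂ) * f σ, ?_, fun σ => ?_⟩
  · obtain ⟨σ, hσ⟩ := Function.ne_iff.1 hf
    refine Function.ne_iff.2 ⟨σ, mul_ne_zero ?_ hσ⟩
    exact_mod_cast (Perm.sign σ).ne_zero
  · calc _ = ∑ i ∈ Finset.univ.erase 0, -((Perm.sign σ : ℤ) : ℂ) * f (swap 0 i * σ) := by
          refine Finset.sum_congr rfl fun i hi => ?_
          beta_reduce
          rw [Perm.sign_mul, Perm.sign_swap (Finset.ne_of_mem_erase hi).symm]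
          simp
      _ = _ := by rw [← Finset.mul_sum, h]; ring

/-- Applying a star of transpositions to an alternating function of `m` points, built from
vectors `Φ x` that vanish at the centre and sum to zero. -/
theorem sum_alternatingMap_swap {α ι M : Type*} [Fintype α] [DecidableEq α] [Fintype ι]
    [DecidableEq ι] [AddCommGroup M] [Module ℂ M] (D : M [⋀^ι]→ₗ[ℂ] ℂ) {Φ : α → M} {p : α}
    (hp : Φ p = 0) (hsum : ∑ x, Φ x = 0) {x : ι → α} (hx : Function.Injective x) :
    ∑ i ∈ Finset.univ.erase p, D (fun j => Φ (swap p i (x j))) =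
      ((Fintype.card α : ℂ) - 1 - Fintype.card ι) * D (fun j => Φ (x j)) := by
  by_cases hxp : ∃ l, x l = p
  · obtain ⟨l, hl⟩ := hxp
    have hterm : ∀ i ∈ Finset.univ.erase p, D (fun j => Φ (swap p i (x j))) =
        D (Function.update (fun j => Φ (x j)) l (Φ i)) := fun i hi => by
      by_cases hi' : ∃ t, x t = i
      · obtain ⟨t, rfl⟩ := hi'
        have htl : t ≠ l := fun h => Finset.ne_of_mem_erase hi (h ▸ hl)
        rw [D.map_coord_zero t (by simp [hp]),
          D.map_eq_zero_of_eq _ (by simp [htl]) htl]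
      · congr 1
        funext j
        by_cases hj : j = l
        · subst hj; simp [hl]
        · rw [Function.update_of_ne hj, swap_apply_of_ne_of_ne (fun h => hj (hx (h.trans hl.symm)))
            fun h => hi' ⟨j, h⟩]
    have h₀ : D (Function.update (fun j => Φ (x j)) l (Φ p)) = 0 :=
      D.map_coord_zero l (by simp [hp])
    rw [Finset.sum_congr rfl hterm, D.map_coord_zero (m := fun j => Φ (x j)) l (by simp [hl, hp]),
      mul_zero, Finset.sum_erase (f := fun i => D (Function.update (fun j => Φ (x j)) l (Φ i))) _ h₀,
      ← D.map_update_sum, hsum]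
    exact D.map_coord_zero l (by simp)
  · push Not at hxp
    have hterm : ∀ i ∈ Finset.univ.erase p, D (fun j => Φ (swap p i (x j))) =
        if i ∈ Finset.univ.image x then 0 else D (fun j => Φ (x j)) := fun i _ => by
      split_ifs with h
      · obtain ⟨t, -, rfl⟩ := Finset.mem_image.1 h
        exact D.map_coord_zero t (by simp [hp])
      · congr 1
        funext j
        rw [swap_apply_of_ne_of_ne (hxp j) fun h' => h (by simp [← h'])]
    have hcard : (((Finset.univ.erase p).filter fun i => i ∉ Finset.univ.image x).card : ℂ) =
        (Fintype.card α : ℂ) - 1 - Fintype.card ι := by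
      have h₁ : ((Finset.univ.erase p).filter fun i => i ∉ Finset.univ.image x) =
          Finset.univ \ insert p (Finset.univ.image x) := by
        ext i; simp
      have h₂ : (insert p (Finset.univ.image x)).card = Fintype.card ι + 1 := by
        rw [Finset.card_insert_of_notMem (by simpa using hxp),
          Finset.card_image_of_injective _ hx, Finset.card_univ]
      have h₃ := Finset.card_sdiff_add_card_eq_card (Finset.subset_univ
        (insert p (Finset.univ.image x)))
      rw [h₂, Finset.card_univ] at h₃
      rw [h₁, ← h₃]
      push_cast
      ring
    rw [Finset.sum_congr rfl hterm, Finset.sum_ite, Finset.sum_const_zero, zero_add,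
      Finset.sum_const, nsmul_eq_mul, hcard]

theorem natCast_mem_roots_adjMatn {N k : ℕ} (hk : 1 ≤ k) (hkN : k ≤ N) :
    (k : ℂ) ∈ (adjMatn (N + 1)).charpoly.roots := by
  let Φ : Fin (N + 1) → Fin (N - k) → ℂ := fun i j =>
    (if i = ⟨j + 1, by omega⟩ then 1 else 0) - if i = Fin.last N then 1 else 0
  let x : Fin (N - k) → Fin (N + 1) := fun j => ⟨j + 1, by omega⟩
  have hx : Function.Injective x := fun i j h => by
    simpa [x, Fin.ext_iff] using h
  have hΦ : Φ 0 = 0 := by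
    funext j
    have h₁ : (0 : Fin (N + 1)) ≠ ⟨j + 1, by omega⟩ := by simp [Fin.ext_iff]
    have h₂ : (0 : Fin (N + 1)) ≠ Fin.last N := by
      rw [Ne, Fin.ext_iff, Fin.val_zero, Fin.val_last]; omega
    simp only [Φ, if_neg h₁, if_neg h₂, sub_zero, Pi.zero_apply]
  have hsum : ∑ i, Φ i = 0 := by
    funext j
    simp [Φ, Finset.sum_apply]
  refine mem_roots_charpoly_adjMatn.2
    ⟨fun σ => Matrix.detRowAlternating fun j => Φ (σ (x j)), ?_, fun σ => ?_⟩
  · refine Function.ne_iff.2 ⟨1, ?_⟩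
    have : (fun j => Φ ((1 : Perm (Fin (N + 1))) (x j))) = (1 : Matrix _ _ ℂ) := by
      ext i j
      simp only [Φ, x, Perm.one_apply, Matrix.one_apply, Fin.ext_iff, Fin.val_last]
      rw [if_neg (by omega : ¬ (i : ℕ) + 1 = N), sub_zero]
      simp
    rw [this]
    exact Matrix.det_one.trans_ne one_ne_zero
  · have := sum_alternatingMap_swap Matrix.detRowAlternating hΦ hsum (σ.injective.comp hx)
    simp only [Function.comp_apply, Fintype.card_fin] at this
    simp only [Perm.mul_apply]
    rw [this, Nat.cast_sub hkN]
    push_cast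
    ring

theorem zero_mem_roots_adjMatn {N : ℕ} (hN : 3 ≤ N) :
    (0 : ℂ) ∈ (adjMatn (N + 1)).charpoly.roots := by
  obtain ⟨h, h₀, h₁, hsum⟩ : ∃ h : Fin (N + 1) → ℂ, h 0 = 0 ∧ h 1 = 1 ∧ ∑ i, h i = 0 := by
    have h01 : (0 : Fin (N + 1)) ≠ 1 := by rw [Ne, Fin.ext_iff, Fin.val_one']; simp; omega
    have h0 : (0 : Fin (N + 1)) ≠ Fin.last N := by simp [Fin.ext_iff]; omega
    have h1 : (1 : Fin (N + 1)) ≠ Fin.last N := by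
      rw [Ne, Fin.ext_iff, Fin.val_one', Fin.val_last, Nat.mod_eq_of_lt (by omega)]; omega
    exact ⟨Pi.single 1 1 - Pi.single (Fin.last N) 1, by simp [h01, h0], by simp [h1],
      by simp [Finset.sum_sub_distrib]⟩
  let F : Fin (N + 1) → Fin (N + 1) → ℂ := fun x y =>
    if x = 0 then (N - 2) * h y else if y = 0 then (N - 2) * h x else -(h x + h y)
  have hF : ∀ x y, F x y = F y x := fun x y => by
    simp only [F]; split_ifs <;> simp_all [add_comm]
  have hcenter : ∀ y ≠ 0, ∑ i ∈ Finset.univ.erase 0, F (swap 0 i 0) (swap 0 i y) = 0 := by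
    intro y hy
    have hy' : y ∈ Finset.univ.erase (0 : Fin (N + 1)) := by simpa using hy
    have hterm : ∀ i ∈ (Finset.univ.erase (0 : Fin (N + 1))).erase y,
        F (swap 0 i 0) (swap 0 i y) = -(h i + h y) := fun i hi => by
      simp only [Finset.mem_erase, Finset.mem_univ, and_true] at hi
      rw [swap_apply_left, swap_apply_of_ne_of_ne hy hi.1.symm]
      simp [F, hi.2, hy]
    have hs := Finset.add_sum_erase _ h hy'
    rw [Finset.sum_erase _ h₀, hsum] at hs
    rw [← Finset.add_sum_erase _ _ hy', Finset.sum_congr rfl hterm, Finset.sum_neg_distrib,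
      Finset.sum_add_distrib, Finset.sum_const, Finset.card_erase_of_mem hy',
      Finset.card_erase_of_mem (Finset.mem_univ _), Finset.card_univ, Fintype.card_fin,
      nsmul_eq_mul, swap_apply_left, swap_apply_right, eq_neg_of_add_eq_zero_right hs]
    simp only [F, hy, if_false, if_true]
    rw [Nat.add_sub_cancel, Nat.cast_sub (by omega)]
    push_cast
    ring
  have hmain : ∀ x y, x ≠ y → ∑ i ∈ Finset.univ.erase 0, F (swap 0 i x) (swap 0 i y) = 0 := by
    intro x y hxy
    by_cases hx : x = 0
    · subst hx; exact hcenter y hxy.symm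
    by_cases hy : y = 0
    · subst hy
      simp only [hF (swap 0 _ x)]
      exact hcenter x hxy
    have hx' : x ∈ Finset.univ.erase (0 : Fin (N + 1)) := by simpa using hx
    have hy' : y ∈ (Finset.univ.erase (0 : Fin (N + 1))).erase x := by simp [hy, hxy.symm]
    have hterm : ∀ i ∈ ((Finset.univ.erase (0 : Fin (N + 1))).erase x).erase y,
        F (swap 0 i x) (swap 0 i y) = -(h x + h y) := fun i hi => by
      simp only [Finset.mem_erase, Finset.mem_univ, and_true] at hi
      rw [swap_apply_of_ne_of_ne hx hi.2.1.symm, swap_apply_of_ne_of_ne hy hi.1.symm]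
      simp [F, hx, hy]
    rw [← Finset.add_sum_erase _ _ hx', ← Finset.add_sum_erase _ _ hy',
      Finset.sum_congr rfl hterm, Finset.sum_const, Finset.card_erase_of_mem hy',
      Finset.card_erase_of_mem hx', Finset.card_erase_of_mem (Finset.mem_univ _),
      Finset.card_univ, Fintype.card_fin, nsmul_eq_mul, swap_apply_right, swap_apply_right,
      swap_apply_of_ne_of_ne hy hxy.symm, swap_apply_of_ne_of_ne hx hxy]
    simp only [F, hx, hy, if_false, if_true]
    rw [show N + 1 - 1 - 1 - 1 = N - 2 by omega, Nat.cast_sub (by omega)]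
    push_cast
    ring
  have h01 : (0 : Fin (N + 1)) ≠ 1 := fun h' => by simp [← h', h₀] at h₁
  refine mem_roots_charpoly_adjMatn.2 ⟨fun σ => F (σ 0) (σ 1), ?_, fun σ => ?_⟩
  · refine Function.ne_iff.2 ⟨1, ?_⟩
    simp only [F, Perm.one_apply, if_true, h₁, mul_one, Pi.zero_apply, sub_ne_zero]
    exact_mod_cast (by omega : N ≠ 2)
  · simpa using hmain (σ 0) (σ 1) fun h' => h01 (σ.injective h')

theorem intCast_mem_roots_adjMatn {N : ℕ} {k : ℤ} (h₀ : k ≠ 0) (h₁ : -(N : ℤ) ≤ k)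
    (h₂ : k ≤ N) : (k : ℂ) ∈ (adjMatn (N + 1)).charpoly.roots := by
  have h := natCast_mem_roots_adjMatn (N := N) (k := k.natAbs) (by omega) (by omega)
  rcases Int.natAbs_eq k with hk | hk
  · rwa [hk, Int.cast_natCast]
  · rw [hk, Int.cast_neg, Int.cast_natCast]
    exact neg_mem_roots_charpoly_adjMatn h

theorem zero_notMem_roots_adjMatn_two : (0 : ℂ) ∉ (adjMatn 2).charpoly.roots := by
  intro h
  obtain ⟨f, hf, h⟩ := mem_roots_charpoly_adjMatn.1 h
  refine hf (funext fun σ => ?_)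
  have h' := h (swap 0 1 * σ)
  rwa [show Finset.univ.erase (0 : Fin (1 + 1)) = {1} by decide, Finset.sum_singleton,
    swap_mul_self_mul, zero_mul] at h'

theorem zero_notMem_roots_adjMatn_three : (0 : ℂ) ∉ (adjMatn 3).charpoly.roots := by
  intro h
  obtain ⟨f, hf, h⟩ := mem_roots_charpoly_adjMatn.1 h
  have h' : ∀ σ, f (swap 0 1 * σ) = -f (swap 0 2 * σ) := fun σ => by
    have h' := h σ
    rw [show Finset.univ.erase (0 : Fin (2 + 1)) = {1, 2} by decide,
      Finset.sum_pair (by decide), zero_mul] at h'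
    exact eq_neg_of_add_eq_zero_left h'
  have hrot : ∀ σ, f (swap 0 1 * (swap 0 2 * σ)) = -f σ := fun σ => by
    rw [h', swap_mul_self_mul]
  refine hf (funext fun σ => ?_)
  have hσ : swap 0 1 * (swap 0 2 * (swap 0 1 * (swap 0 2 * (swap 0 1 * (swap 0 2 * σ))))) = σ := by
    simp only [← mul_assoc]
    rw [show swap (0 : Fin 3) 1 * swap 0 2 * swap 0 1 * swap 0 2 * swap 0 1 * swap 0 2 = 1 by
      decide, one_mul]
  have hf' := congrArg f hσ
  rw [hrot, hrot, hrot] at hf'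
  rw [Pi.zero_apply]
  linear_combination -hf' / 2

/-- For `n > 3`, the set of eigenvalues of the adjacency matrix of `G_n` is exactly
`{−(n−1), …, n−1}` (in particular `0` is an eigenvalue); for `n ∈ {2, 3}` it is exactly
`{−(n−1), …, n−1} \ {0}`. -/
theorem cayley_spectrum_set (n : ℕ) (hn : 2 ≤ n) :
    (3 < n → ∀ μ : ℂ, μ ∈ (adjMatn n).charpoly.roots ↔
      ∃ k : ℤ, -((n : ℤ) - 1) ≤ k ∧ k ≤ (n : ℤ) - 1 ∧ μ = (k : ℂ)) ∧
    (n = 2 ∨ n = 3 → ∀ μ : ℂ, μ ∈ (adjMatn n).charpoly.roots ↔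
      ∃ k : ℤ, -((n : ℤ) - 1) ≤ k ∧ k ≤ (n : ℤ) - 1 ∧ k ≠ 0 ∧ μ = (k : ℂ)) := by
  obtain ⟨N, rfl⟩ : ∃ N, n = N + 1 := ⟨n - 1, by omega⟩
  have hcast : ((N + 1 : ℕ) : ℤ) - 1 = N := by push_cast; ring
  rw [hcast]
  refine ⟨fun h μ => ⟨exists_int_of_mem_roots_adjMatn, ?_⟩, fun h μ => ⟨fun hμ => ?_, ?_⟩⟩
  · rintro ⟨k, hk₁, hk₂, rfl⟩
    by_cases hk : k = 0
    · subst hk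
      exact_mod_cast zero_mem_roots_adjMatn (by omega)
    · exact intCast_mem_roots_adjMatn hk hk₁ hk₂
  · obtain ⟨k, hk₁, hk₂, rfl⟩ := exists_int_of_mem_roots_adjMatn hμ
    refine ⟨k, hk₁, hk₂, ?_, rfl⟩
    rintro rfl
    rw [Int.cast_zero] at hμ
    rcases h with h | h <;> rw [h] at hμ
    · exact zero_notMem_roots_adjMatn_two hμ
    · exact zero_notMem_roots_adjMatn_three hμ
  · rintro ⟨k, hk₁, hk₂, hk, rfl⟩
    exact intCast_mem_roots_adjMatn hk hk₁ hk₂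
end

section
/- Let n ≥ 2 and 1 ≤ l ≤ n−1, and let mul(k) denote the multiplicity of k as an eigenvalue of the adjacency matrix of the Cayley graph G_n of 𝔖_n generated by the transpositions (1 i), 2 ≤ i ≤ n. Then mul(l) ≥ C(n−2, l−1) · C(n−1, l) and mul(−l) ≥ C(n−2, l−1) · C(n−1, l). -/
open Equiv Polynomial

section RankOne

variable {ι R : Type*} [Fintype ι] [DecidableEq ι] [CommRing R]

/-- A rank one perturbation of a determinant, expanded along the rows. -/
theorem det_add_vecMulVec (M : Matrix ι ι R) (u w : ι → R) :
    (M + Matrix.vecMulVec u w).det = M.det + ∑ i, u i * (M.updateRow i w).det := by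
  have key : ∀ s : Finset ι,
      (Matrix.of fun i j => M i j + if i ∈ s then u i * w j else 0).det =
        M.det + ∑ i ∈ s, u i * (M.updateRow i w).det := by
    intro s
    induction s using Finset.induction_on with
    | empty => simp; rfl
    | insert a s ha ih =>
      set N : Matrix ι ι R := Matrix.of fun i j => M i j + if i ∈ s then u i * w j else 0 with hN
      have h1 : (Matrix.of fun i j => M i j + if i ∈ insert a s then u i * w j else 0) =
          N.updateRow a (N a + u a • w) := by
        ext i j
        by_cases hi : i = a
        · subst hi
          simp [hN, ha]
        · simp [hN, hi]
      have h2 : (N.updateRow a w).det = (M.updateRow a w).det := by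
        refine Matrix.det_eq_of_forall_row_eq_smul_add_const
          (fun i => if i ∈ s then u i else 0) a (by simp [ha]) ?_
        intro i j
        by_cases hi : i = a
        · subst hi
          simp [ha]
        · simp [hN, hi]
      rw [h1, Matrix.det_updateRow_add, Matrix.det_updateRow_smul, Matrix.updateRow_eq_self, ih, h2,
        Finset.sum_insert ha]
      ring
  rw [← key Finset.univ]
  congr 1
  ext i j
  simp [Matrix.vecMulVec_apply]

/-- If the rank one matrices `u t ⊗ w t` add up to `-M`, the corresponding perturbations of
`det M` add up to `(#T - #ι) det M`. -/
theorem sum_det_add_vecMulVec {T : Type*} [Fintype T] (M : Matrix ι ι R) (u w : T → ι → R)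
    (h : ∀ i j, ∑ t, u t i * w t j = -M i j) :
    ∑ t, (M + Matrix.vecMulVec (u t) (w t)).det =
      ((Fintype.card T : R) - Fintype.card ι) * M.det := by
  have hrow : ∀ i, ∑ t, u t i * (M.updateRow i (w t)).det = -M.det := by
    intro i
    have h1 : -(M i) = ∑ t, u t i • w t := by
      ext j
      simp [Finset.sum_apply, h]
    have h2 : (M.updateRow i (-(M i))).det = -M.det := by
      have := Matrix.det_updateRow_smul M i (-1) (M i)
      rw [Matrix.updateRow_eq_self] at this
      simpa using this
    rw [← h2, h1]
    refine Eq.trans ?_ ((Matrix.detRowAlternating (R := R)).map_update_sum Finset.univ i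
      (fun t => u t i • w t) M).symm
    exact Finset.sum_congr rfl fun t _ => (Matrix.det_updateRow_smul M i (u t i) (w t)).symm
  simp_rw [det_add_vecMulVec, Finset.sum_add_distrib]
  rw [Finset.sum_comm]
  simp_rw [hrow]
  simp
  ring

end RankOne

section DifferenceMinor

variable {V : Type*} [DecidableEq V] {k : ℕ}

/-- The minor `det ⟨e_{α i} - e_p, π (e_{β j} - e_q)⟩` of the permutation representation. -/
noncomputable def differenceMinor (α : Fin k → V) (p : V) (β : Fin k → V) (q : V)
    (π : Perm V) : ℂ :=
  (Matrix.of fun i j : Fin k =>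
    (((if π (β j) = α i then 1 else 0) - (if π q = α i then 1 else 0)) -
      ((if π (β j) = p then 1 else 0) - (if π q = p then 1 else 0)) : ℂ)).det

theorem differenceMinor_inv (α : Fin k → V) (p : V) (β : Fin k → V) (q : V) (π : Perm V) :
    differenceMinor α p β q π⁻¹ = differenceMinor β q α p π := by
  unfold differenceMinor
  rw [← Matrix.det_transpose]
  congr 1
  ext i j
  have h : ∀ a b : V, (π⁻¹ a = b) = (π b = a) := by
    intro a b
    rw [Equiv.Perm.inv_eq_iff_eq]
    exact propext eq_comm
  simp only [Matrix.transpose_apply, Matrix.of_apply, h]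
  ring

theorem differenceMinor_mul_swap (α : Fin k → V) (p : V) {β : Fin k → V} {q : V}
    (hβ : Function.Injective β) (hq : ∀ j, β j ≠ q) (j₀ : Fin k) (π : Perm V) :
    differenceMinor α p β q (π * swap (β j₀) q) = -differenceMinor α p β q π := by
  set M := Matrix.of fun i j : Fin k =>
    (((if π (β j) = α i then 1 else 0) - (if π q = α i then 1 else 0)) -
      ((if π (β j) = p then 1 else 0) - (if π q = p then 1 else 0)) : ℂ) with hM
  set N := Matrix.of fun i j : Fin k => M i j + (if j = j₀ then 0 else -1) * M i j₀ with hN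
  have hNM : N.det = M.det := by
    rw [← Matrix.det_transpose, ← Matrix.det_transpose M]
    refine Matrix.det_eq_of_forall_row_eq_smul_add_const
      (fun j => if j = j₀ then 0 else -1) j₀ (by simp) ?_
    intro i j
    simp [hN]
  have h := Matrix.det_mul_row (fun j => if j = j₀ then (-1 : ℂ) else 1) N
  rw [Finset.prod_ite_eq' Finset.univ j₀ (fun _ => (-1 : ℂ)), hNM] at h
  simp only [Finset.mem_univ, if_true, neg_one_mul] at h
  unfold differenceMinor
  rw [← hM, ← h]
  congr 1
  ext i j
  by_cases hj : j = j₀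
  · subst hj
    simp [hN, hM]
    ring
  · have h1 : swap (β j₀) q (β j) = β j :=
      swap_apply_of_ne_of_ne (fun h => hj (hβ h)) (hq j)
    simp [hN, hM, hj, h1]
    ring

theorem differenceMinor_swap_mul {α : Fin k → V} {p : V} (β : Fin k → V) (q : V)
    (hα : Function.Injective α) (hp : ∀ i, α i ≠ p) (i₀ : Fin k) (π : Perm V) :
    differenceMinor α p β q (swap (α i₀) p * π) = -differenceMinor α p β q π := by
  rw [← differenceMinor_inv, mul_inv_rev, swap_inv, differenceMinor_mul_swap β q hα hp,
    differenceMinor_inv]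

theorem differenceMinor_re_pos {α : Fin k → V} {p : V} {β : Fin k → V} {q : V}
    (hα : Function.Injective α) (hp : ∀ i, α i ≠ p) (hq : ∀ j, β j ≠ q) {π : Perm V}
    (hπ : ∀ i, π (β i) = α i) : 0 < (differenceMinor α p β q π).re := by
  have h : differenceMinor α p β q π =
      1 + ∑ i : Fin k, if π q = p then 1 else 0 := by
    have h1 := det_add_vecMulVec (1 : Matrix (Fin k) (Fin k) ℂ)
      (fun _ => if π q = p then 1 else 0) (fun _ => 1)
    have h2 : ∀ i : Fin k, ((1 : Matrix (Fin k) (Fin k) ℂ).updateRow i (fun _ => 1)).det = 1 := by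
      intro i
      have : (fun _ => 1 : Fin k → ℂ) = ∑ j, (1 : ℂ) • (1 : Matrix (Fin k) (Fin k) ℂ) j := by
        funext j
        rw [Finset.sum_apply]
        simp [Matrix.one_apply]
      have h3 := Matrix.det_updateRow_sum (1 : Matrix (Fin k) (Fin k) ℂ) i (fun _ => 1)
      rw [← this] at h3
      simpa using h3
    rw [Matrix.det_one] at h1
    simp only [h2, mul_one] at h1
    rw [← h1]
    unfold differenceMinor
    congr 1
    ext i j
    have h4 : π q ≠ α i := by
      rw [← hπ i]
      exact fun h => hq i (π.injective h).symm
    simp [hπ, h4, hp, Matrix.one_apply, Matrix.vecMulVec_apply, hα.eq_iff, eq_comm (a := i)]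
  rw [h]
  split_ifs
  · simp
    positivity
  · simp

variable [Fintype V]

/-- The permutations fixing every point of a family. -/
def fixingPerms (β : Fin k → V) : Finset (Perm V) :=
  Finset.univ.filter fun τ => ∀ i, τ (β i) = β i

theorem mem_fixingPerms {β : Fin k → V} {τ : Perm V} :
    τ ∈ fixingPerms β ↔ ∀ i, τ (β i) = β i := by
  simp [fixingPerms]

theorem sum_fixingPerms_mul_eq_zero (f : Perm V → ℂ) {β : Fin k → V} {x y : V}
    (hx : ∀ i, β i ≠ x) (hy : ∀ i, β i ≠ y) (hf : ∀ π, f (π * swap x y) = -f π) (σ : Perm V) :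
    ∑ τ ∈ fixingPerms β, f (σ * τ) = 0 := by
  have h : ∑ τ ∈ fixingPerms β, f (σ * τ) = ∑ τ ∈ fixingPerms β, -f (σ * τ) := by
    refine Finset.sum_equiv (Equiv.mulRight (swap x y)) ?_ ?_
    · intro τ
      simp [mem_fixingPerms, swap_apply_of_ne_of_ne (hx _) (hy _)]
    · intro τ _
      simp [← mul_assoc, hf]
  rw [Finset.sum_neg_distrib] at h
  exact self_eq_neg.mp h

theorem sum_fixingPerms_mul_eq_zero' (f : Perm V → ℂ) {β : Fin k → V} {x y : V}
    (hx : ∀ i, β i ≠ x) (hy : ∀ i, β i ≠ y) (hf : ∀ π, f (swap x y * π) = -f π) (σ : Perm V) :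
    ∑ τ ∈ fixingPerms β, f (τ * σ) = 0 := by
  have h : ∑ τ ∈ fixingPerms β, f (τ * σ) = ∑ τ ∈ fixingPerms β, -f (τ * σ) := by
    refine Finset.sum_equiv (Equiv.mulLeft (swap x y)) ?_ ?_
    · intro τ
      simp only [mem_fixingPerms, Equiv.coe_mulLeft, Perm.mul_apply]
      refine forall_congr' fun i => ?_
      rw [swap_apply_eq_iff, swap_apply_of_ne_of_ne (hx _) (hy _)]
    · intro τ _
      simp [mul_assoc, hf]
  rw [Finset.sum_neg_distrib] at h
  exact self_eq_neg.mp h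

theorem linearIndependent_differenceMinor {I J : Type*} {p q : V}
    {α : I → Fin k → V} {β : J → Fin k → V}
    (hα : ∀ a, Function.Injective (α a)) (hp : ∀ a i, α a i ≠ p)
    (hα' : ∀ a a', a ≠ a' → ∃ i, ∀ j, α a' j ≠ α a i)
    (hβ : ∀ b, Function.Injective (β b)) (hq : ∀ b j, β b j ≠ q)
    (hβ' : ∀ b b', b ≠ b' → ∃ i, ∀ j, β b' j ≠ β b i) :
    LinearIndependent ℂ
      (fun c : I × J => differenceMinor (α c.1) p (β c.2) q) := by
  rw [linearIndependent_iff']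
  rintro s g hg ⟨a₀, b₀⟩ hs
  obtain ⟨σ, hσ⟩ : ∃ σ : Perm V, ∀ i, σ (β b₀ i) = α a₀ i := by
    obtain ⟨σ, hσ⟩ := (Equiv.Perm.isMultiplyPretransitive V k).exists_smul_eq
      ⟨β b₀, hβ b₀⟩ ⟨α a₀, hα a₀⟩
    exact ⟨σ, fun i => congrArg (fun e : Fin k ↪ V => e i) hσ⟩
  let L : (Perm V → ℂ) → ℂ := fun f =>
    ∑ τ ∈ fixingPerms (α a₀), ∑ τ' ∈ fixingPerms (β b₀), f (τ * σ * τ')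
  have hL : L (∑ c ∈ s, g c • differenceMinor (α c.1) p (β c.2) q) =
      ∑ c ∈ s, g c * L (differenceMinor (α c.1) p (β c.2) q) := by
    simp only [L, Finset.sum_apply, Pi.smul_apply, smul_eq_mul, Finset.mul_sum]
    rw [Finset.sum_comm]
    simp_rw [Finset.sum_comm (s := s)]
    rw [Finset.sum_comm]
  have hzero : ∀ c : I × J, c ≠ (a₀, b₀) → L (differenceMinor (α c.1) p (β c.2) q) = 0 := by
    rintro ⟨a, b⟩ hc
    by_cases hb : b = b₀
    · have ha : a ≠ a₀ := fun h => hc (by rw [h, hb])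
      obtain ⟨i, hi⟩ := hα' a a₀ ha
      simp only [L]
      rw [Finset.sum_comm]
      refine Finset.sum_eq_zero fun τ' _ => ?_
      simp_rw [mul_assoc]
      exact sum_fixingPerms_mul_eq_zero' _ hi (hp a₀)
        (differenceMinor_swap_mul _ _ (hα a) (hp a) i) _
    · obtain ⟨i, hi⟩ := hβ' b b₀ hb
      exact Finset.sum_eq_zero fun τ _ => sum_fixingPerms_mul_eq_zero _ hi (hq b₀)
        (differenceMinor_mul_swap _ _ (hβ b) (hq b) i) _
  have hpos : L (differenceMinor (α a₀) p (β b₀) q) ≠ 0 := by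
    have : 0 < (L (differenceMinor (α a₀) p (β b₀) q)).re := by
      simp only [L, Complex.re_sum]
      refine Finset.sum_pos (fun τ hτ => Finset.sum_pos (fun τ' hτ' => ?_) ?_) ?_
      · rw [mem_fixingPerms] at hτ hτ'
        exact differenceMinor_re_pos (hα a₀) (hp a₀) (hq b₀) fun i => by simp [hτ', hσ, hτ]
      · exact ⟨1, by simp [mem_fixingPerms]⟩
      · exact ⟨1, by simp [mem_fixingPerms]⟩
    intro h
    simp [h] at this
  rw [hg, Finset.sum_eq_single (a₀, b₀) (fun c _ hc => by rw [hzero c hc, mul_zero])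
    (fun h => absurd hs h)] at hL
  have h0 : L 0 = 0 := by simp [L]
  rw [h0] at hL
  exact (mul_eq_zero.mp hL.symm).resolve_right hpos

end DifferenceMinor

section Adjacency

theorem adjMatn_mulVec_apply (m : ℕ) (f : Perm (Fin (m + 1)) → ℂ) (σ : Perm (Fin (m + 1))) :
    (adjMatn (m + 1)).mulVec f σ = ∑ t : Fin m, f (swap 0 t.succ * σ) := by
  have h : ∀ τ, adjMatn (m + 1) σ τ =
      ∑ t : Fin m, if swap 0 t.succ * σ = τ then 1 else 0 := by
    intro τ
    simp only [adjMatn]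
    split_ifs with h
    · obtain ⟨i, hi, hτ⟩ := h
      obtain ⟨t, rfl⟩ := Fin.exists_succ_eq.mpr hi
      rw [Finset.sum_eq_single t]
      · rw [if_pos (by rw [← hτ]; simp)]
      · intro t' _ ht'
        rw [if_neg]
        intro h'
        rw [mul_inv_eq_iff_eq_mul.mp hτ, mul_left_inj] at h'
        have := congrArg (fun e : Perm (Fin (m + 1)) => e 0) h'
        simp only [swap_apply_left, Fin.succ_inj] at this
        exact ht' this
      · simp
    · refine (Finset.sum_eq_zero fun t _ => if_neg fun h' => h ⟨t.succ, Fin.succ_ne_zero t, ?_⟩).symm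
      rw [← h']
      simp
  simp only [Matrix.mulVec, dotProduct, h, Finset.sum_mul]
  rw [Finset.sum_comm]
  simp

theorem adjMatn_mulVec_differenceMinor {m k : ℕ} {α : Fin k → Fin (m + 1)} {p : Fin (m + 1)}
    (β : Fin k → Fin (m + 1)) (q : Fin (m + 1)) (hα : ∀ i, α i ≠ 0) (hp : p ≠ 0) :
    (adjMatn (m + 1)).mulVec (differenceMinor α p β q) =
      ((m : ℂ) - k) • differenceMinor α p β q := by
  ext σ
  rw [adjMatn_mulVec_apply, Pi.smul_apply, smul_eq_mul]
  let x : Fin k → Fin (m + 1) → ℂ := fun i u =>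
    (if u = α i then 1 else 0) - (if u = p then 1 else 0)
  let e : Fin m → Fin (m + 1) → ℂ := fun t u =>
    (if u = 0 then 1 else 0) - (if u = t.succ then 1 else 0)
  have hx0 : ∀ i, x i 0 = 0 := fun i => by simp [x, (hα i).symm, hp.symm]
  have hmin : ∀ π, differenceMinor α p β q π =
      (Matrix.of fun i j => x i (π (β j)) - x i (π q)).det := by
    intro π
    unfold differenceMinor
    congr 1
    ext i j
    simp only [x, Matrix.of_apply]
    ring
  have hswap : ∀ i t u, x i (swap 0 (Fin.succ t) u) = x i u + x i t.succ * e t u := by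
    intro i t u
    rw [swap_apply_def]
    split_ifs with h1 h2
    · simp [h1, hx0, e, (Fin.succ_ne_zero t).symm]
    · simp [h2, hx0, e]
    · simp [h1, h2, e]
  have hsum : ∀ i u, ∑ t : Fin m, x i t.succ * e t u = -x i u := by
    intro i u
    have h1 : ∑ t, x i t = 0 := by simp [x]
    rw [Fin.sum_univ_succ, hx0, zero_add] at h1
    have h2 : ∑ t : Fin m, x i t.succ * (if u = t.succ then 1 else 0) = x i u := by
      have : ∑ t, x i t * (if u = t then 1 else 0) = x i u := by simp
      rwa [Fin.sum_univ_succ, hx0, zero_mul, zero_add] at this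
    simp only [e, mul_sub, Finset.sum_sub_distrib, h2, ← Finset.sum_mul, h1]
    simp
  have := sum_det_add_vecMulVec (Matrix.of fun i j => x i (σ (β j)) - x i (σ q))
    (fun t i => x i (Fin.succ t)) (fun t j => e t (σ (β j)) - e t (σ q)) (by
      intro i j
      simp only [mul_sub, Finset.sum_sub_distrib, hsum, Matrix.of_apply]
      ring)
  rw [Fintype.card_fin, Fintype.card_fin] at this
  rw [hmin, ← this]
  refine Finset.sum_congr rfl fun t _ => ?_
  rw [hmin]
  congr 1
  ext i j
  simp only [Perm.mul_apply, hswap, Matrix.add_apply, Matrix.of_apply, Matrix.vecMulVec_apply]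
  ring

theorem adjMatn_mulVec_sign_mul {m : ℕ} {f : Perm (Fin (m + 1)) → ℂ} {μ : ℂ}
    (hf : (adjMatn (m + 1)).mulVec f = μ • f) :
    (adjMatn (m + 1)).mulVec (fun σ => ((Perm.sign σ : ℤ) : ℂ) * f σ) =
      (-μ) • fun σ => ((Perm.sign σ : ℤ) : ℂ) * f σ := by
  ext σ
  have h := congrFun hf σ
  rw [adjMatn_mulVec_apply] at h ⊢
  have hs : ∀ t : Fin m, Perm.sign (swap 0 t.succ) = -1 := fun t =>
    Perm.sign_swap (Fin.succ_ne_zero t).symm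
  simp only [Perm.sign_mul, hs, Pi.smul_apply, smul_eq_mul] at h ⊢
  push_cast
  rw [← Finset.mul_sum, h]
  ring

end Adjacency

theorem card_le_count_roots_charpoly {ι κ : Type*} [Fintype ι] [DecidableEq ι] [Fintype κ]
    (A : Matrix ι ι ℂ) (μ : ℂ) {v : κ → ι → ℂ} (hv : LinearIndependent ℂ v)
    (hA : ∀ c, A.mulVec (v c) = μ • v c) :
    Fintype.card κ ≤ A.charpoly.roots.count μ := by
  rw [Polynomial.count_roots, ← Matrix.charpoly_toLin']
  refine le_trans ?_ (LinearMap.finrank_eigenspace_le (Matrix.toLin' A) μ)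
  have hmem : ∀ c, v c ∈ Module.End.eigenspace (Matrix.toLin' A) μ := fun c => by
    rw [Module.End.mem_eigenspace_iff, Matrix.toLin'_apply, hA]
  have : LinearIndependent ℂ
      (fun c => (⟨v c, hmem c⟩ : Module.End.eigenspace (Matrix.toLin' A) μ)) :=
    LinearIndependent.of_comp (Submodule.subtype _) hv
  exact this.fintype_card_le_finrank

theorem exists_forall_orderEmbOfFin_ne {r k : ℕ} {s t : Finset (Fin r)} (hs : s.card = k)
    (ht : t.card = k) (hst : s ≠ t) :
    ∃ i, ∀ j, t.orderEmbOfFin ht j ≠ s.orderEmbOfFin hs i := by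
  by_contra! h
  refine hst (Finset.eq_of_subset_of_card_le (fun x hx => ?_) (by omega))
  obtain ⟨i, rfl⟩ : x ∈ Set.range (s.orderEmbOfFin hs) := by simpa using hx
  obtain ⟨j, hj⟩ := h i
  rw [← hj]
  exact t.orderEmbOfFin_mem ht j

/-- For `1 ≤ l ≤ n − 1`, the multiplicity of `l` (and of `−l`) as an eigenvalue of the
adjacency matrix of `G_n` is at least `C(n−2, l−1) · C(n−1, l)`. -/
theorem cayley_multiplicity_lower_bound (n l : ℕ) (hn : 2 ≤ n) (hl : 1 ≤ l)
    (hln : l ≤ n - 1) :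
    (n - 2).choose (l - 1) * (n - 1).choose l ≤
      ((adjMatn n).charpoly.roots).count ((l : ℂ)) ∧
    (n - 2).choose (l - 1) * (n - 1).choose l ≤
      ((adjMatn n).charpoly.roots).count (-(l : ℂ)) := by
  obtain ⟨m, rfl⟩ : ∃ m, n = m + 2 := ⟨n - 2, by omega⟩
  obtain ⟨k, hk⟩ : ∃ k, l + k = m + 1 := ⟨m + 1 - l, by omega⟩
  let α : {s : Finset (Fin m) // s.card = k} → Fin k → Fin (m + 2) := fun s i =>
    (s.1.orderEmbOfFin s.2 i).succ.succ
  let β : {s : Finset (Fin (m + 1)) // s.card = k} → Fin k → Fin (m + 2) := fun s i =>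
    (s.1.orderEmbOfFin s.2 i).succ
  have hli := linearIndependent_differenceMinor (p := (1 : Fin (m + 2))) (q := 0) (α := α) (β := β)
    (fun a i j h => by simpa [α] using h)
    (fun a i h => by simpa [α] using congrArg Fin.val h)
    (fun a a' h => by
      simpa [α] using exists_forall_orderEmbOfFin_ne a.2 a'.2 (Subtype.coe_ne_coe.mpr h))
    (fun b i j h => by simpa [β] using h)
    (fun b i => Fin.succ_ne_zero _)
    (fun b b' h => by
      simpa [β] using exists_forall_orderEmbOfFin_ne b.2 b'.2 (Subtype.coe_ne_coe.mpr h))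
  have hcard : Fintype.card ({s : Finset (Fin m) // s.card = k} ×
      {s : Finset (Fin (m + 1)) // s.card = k}) =
      (m + 2 - 2).choose (l - 1) * (m + 2 - 1).choose l := by
    rw [Fintype.card_prod, Fintype.card_finset_len, Fintype.card_finset_len, Fintype.card_fin,
      Fintype.card_fin]
    congr 1
    · exact Nat.choose_symm_of_eq_add (by omega)
    · exact Nat.choose_symm_of_eq_add (by omega)
  have hlk : ((m + 1 : ℕ) : ℂ) - k = l := by
    rw [← hk]
    push_cast
    ring
  have heig : ∀ c : {s : Finset (Fin m) // s.card = k} × {s : Finset (Fin (m + 1)) // s.card = k},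
      (adjMatn (m + 2)).mulVec (differenceMinor (α c.1) 1 (β c.2) 0) =
        (l : ℂ) • differenceMinor (α c.1) 1 (β c.2) 0 := fun c => by
    rw [← hlk]
    exact adjMatn_mulVec_differenceMinor _ _ (fun i => Fin.succ_ne_zero _) (by simp)
  rw [← hcard]
  refine ⟨card_le_count_roots_charpoly _ _ hli heig,
    card_le_count_roots_charpoly _ _ ?_ fun c => adjMatn_mulVec_sign_mul (heig c)⟩
  refine hli.map' (LinearMap.mulLeft ℂ fun σ : Perm (Fin (m + 2)) => ((Perm.sign σ : ℤ) : ℂ)) ?_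
  refine LinearMap.ker_eq_bot.mpr fun f g hfg => funext fun σ => ?_
  exact mul_left_cancel₀ (by simp) (congrFun hfg σ)
end

section
/- Let p ≥ 0 and n ≥ p + 1. The number of 2p-tuples (i_1, …, i_{2p}) ∈ {1, …, n−1}^{2p} such that the set {i_1, …, i_{2p}} has cardinality exactly p and the product of transpositions (i_1 n)(i_2 n)⋯(i_{2p} n) is the identity permutation equals (n−1)(n−2)⋯(n−p) · Cat(p), where Cat(p) = (2p)!/((p+1)! p!) is the p-th Catalan number. -/
open Equiv

/-- The `p`-th Catalan number `Cat(p) = (2p)! / ((p+1)! p!)`. -/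
def Cat (p : ℕ) : ℕ := (2 * p).factorial / ((p + 1).factorial * p.factorial)

/-- The number of lattice paths with steps `±1` going from height `h` to height `0` with `k`
up-steps and staying nonnegative. -/
def ballot : ℕ → ℕ → ℕ
  | 0, _ => 1
  | k + 1, 0 => ballot k 1
  | k + 1, h + 1 => ballot (k + 1) h + ballot k (h + 2)

theorem ballot_mul_factorial_mul_factorial (k h : ℕ) :
    ballot k h * (k.factorial * (k + h + 1).factorial) = (h + 1) * (2 * k + h).factorial := by
  induction k, h using ballot.induct with
  | case1 h => simp [ballot, Nat.factorial_succ]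
  | case2 k ih =>
    rw [ballot, Nat.factorial_succ k]
    have e1 : k + 1 + 0 + 1 = k + 1 + 1 := by ring
    have e2 : 2 * (k + 1) + 0 = 2 * k + 1 + 1 := by ring
    rw [e1, e2, Nat.factorial_succ (2 * k + 1)]
    linear_combination (k + 1) * ih
  | case3 k h ih1 ih2 =>
    have e1 : k + 1 + (h + 1) + 1 = k + h + 2 + 1 := by ring
    have e2 : 2 * (k + 1) + (h + 1) = 2 * k + h + 2 + 1 := by ring
    have e3 : k + 1 + h + 1 = k + h + 2 := by ring
    have e4 : 2 * (k + 1) + h = 2 * k + h + 2 := by ring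
    have e5 : k + (h + 2) + 1 = k + h + 2 + 1 := by ring
    have e6 : 2 * k + (h + 2) = 2 * k + h + 2 := by ring
    rw [e3, e4] at ih1
    rw [e5, e6] at ih2
    rw [ballot, e1, e2, Nat.factorial_succ (2 * k + h + 2)]
    rw [Nat.factorial_succ k] at *
    rw [Nat.factorial_succ (k + h + 2)] at *
    rw [Nat.succ_eq_add_one] at *
    linear_combination (k + h + 3) * ih1 + (k + 1) * ih2

theorem ballot_zero_right (p : ℕ) : ballot p 0 = Cat p := by
  have h := ballot_mul_factorial_mul_factorial p 0
  simp only [Nat.add_zero, Nat.zero_add, Nat.one_mul] at h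
  exact (Nat.div_eq_of_eq_mul_left (by positivity) (by rw [← h, mul_comm (p + 1).factorial])).symm

section StackWords

variable {α : Type*} [DecidableEq α]

/-- The words of length `m` that empty the stack `s`, where each letter either pops the top of the
stack or is a letter of `A`, not used before, that is pushed onto the stack. -/
def stackWords : ℕ → List α → Finset α → Finset (List α)
  | 0, [], _ => {[]}
  | 0, _ :: _, _ => ∅
  | m + 1, [], A => A.biUnion fun x => (stackWords m [x] (A.erase x)).image (List.cons x)
  | m + 1, t :: s, A => (stackWords m s A).image (List.cons t) ∪
      A.biUnion fun x => (stackWords m (x :: t :: s) (A.erase x)).image (List.cons x)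

theorem stackWords_eq_empty {m : ℕ} {s : List α} {A : Finset α} (h : m < s.length) :
    stackWords m s A = ∅ := by
  induction m generalizing s A with
  | zero =>
    cases s with
    | nil => simp at h
    | cons t s => rfl
  | succ m ih =>
    cases s with
    | nil => simp at h
    | cons t s =>
      have h1 : stackWords m s A = ∅ := ih (by simpa using h)
      have h2 (x : α) : stackWords m (x :: t :: s) (A.erase x) = ∅ :=
        ih (by simp at h ⊢; omega)
      simp [stackWords, h1, h2, Finset.eq_empty_iff_forall_notMem]

theorem card_biUnion_image_cons (A : Finset α) (F : α → Finset (List α)) :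
    (A.biUnion fun x => (F x).image (List.cons x)).card = ∑ x ∈ A, (F x).card := by
  rw [Finset.card_biUnion]
  · exact Finset.sum_congr rfl fun x _ => Finset.card_image_of_injective _ List.cons_injective
  · intro x _ y _ hxy
    rw [Function.onFun, Finset.disjoint_left]
    intro w hx hy
    simp only [Finset.mem_image] at hx hy
    grind

theorem card_stackWords {m k : ℕ} {s : List α} {A : Finset α} (hm : m = 2 * k + s.length)
    (hs : ∀ x ∈ s, x ∉ A) :
    (stackWords m s A).card = A.card.descFactorial k * ballot k s.length := by
  induction m generalizing k s A with
  | zero =>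
    obtain rfl : k = 0 := by omega
    obtain rfl : s = [] := List.length_eq_zero_iff.mp (by omega)
    simp [stackWords, ballot]
  | succ m ih =>
    have push (k' : ℕ) (hk : k = k' + 1) :
        ∑ x ∈ A, (stackWords m (x :: s) (A.erase x)).card =
          A.card.descFactorial k * ballot k' (s.length + 1) := by
      subst hk
      have h1 : ∀ x ∈ A, (stackWords m (x :: s) (A.erase x)).card =
          (A.card - 1).descFactorial k' * ballot k' (s.length + 1) := by
        intro x hx
        rw [ih (k := k') (by simp; omega) (by
          intro y hy
          rcases List.mem_cons.mp hy with rfl | hy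
          · simp
          · simp [hs y hy]), Finset.card_erase_of_mem hx, List.length_cons]
      rw [Finset.sum_congr rfl h1, Finset.sum_const, smul_eq_mul]
      rcases A.card.eq_zero_or_pos with h0 | h0
      · simp [h0]
      · obtain ⟨a, ha⟩ := Nat.exists_eq_add_of_lt h0
        have ha' : A.card = a + 1 := by omega
        rw [ha', Nat.succ_descFactorial_succ, Nat.add_sub_cancel, mul_assoc]
    cases s with
    | nil =>
      simp only [List.length_nil] at *
      obtain ⟨k', rfl⟩ : ∃ k', k = k' + 1 := ⟨k - 1, by omega⟩
      rw [stackWords, card_biUnion_image_cons, push k' rfl, ballot]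
    | cons t s =>
      have hpop := ih (k := k) (s := s) (A := A) (by simp at hm; omega)
        fun x hx => hs x (List.mem_cons_of_mem _ hx)
      rw [stackWords, Finset.card_union_of_disjoint, card_biUnion_image_cons,
        Finset.card_image_of_injective _ List.cons_injective, hpop]
      · cases k with
        | zero =>
          have h0 (x : α) : stackWords m (x :: t :: s) (A.erase x) = ∅ :=
            stackWords_eq_empty (by simp at hm ⊢; omega)
          simp [h0, ballot]
        | succ k =>
          rw [push k rfl, List.length_cons, ballot]
          ring
      · rw [Finset.disjoint_left]
        intro w h1 h2
        simp only [Finset.mem_image, Finset.mem_biUnion] at h1 h2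
        have := hs t
        grind

theorem prod_map_swap_apply_of_notMem {c x : α} {w : List α} (hc : x ≠ c) (hx : x ∉ w) :
    (w.map fun a => swap a c).prod x = x := by
  induction w with
  | nil => rfl
  | cons a w ih =>
    simp only [List.mem_cons, not_or] at hx
    rw [List.map_cons, List.prod_cons, Perm.mul_apply, ih hx.2, swap_apply_of_ne_of_ne hx.1 hc]

theorem prod_map_swap_ne_one_of_stuck {c t x : α} {u v : List α} (htc : t ≠ c) (hxc : x ≠ c)
    (hxt : x ≠ t) (hu : t ∉ u) (hv : x ∉ v) :
    ((u ++ t :: x :: v).map fun a => swap a c).prod ≠ 1 := by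
  intro h
  have := congrArg (fun σ : Perm α => σ x) h
  simp only [List.map_append, List.map_cons, List.prod_append, List.prod_cons, Perm.mul_apply,
    prod_map_swap_apply_of_notMem hxc hv, swap_apply_left, swap_apply_right,
    prod_map_swap_apply_of_notMem htc hu, Perm.one_apply] at this
  exact hxt this.symm

theorem two_le_count_of_prod_map_swap_eq_one {c x : α} {w : List α} (hxc : x ≠ c) (hx : x ∈ w)
    (h : (w.map fun a => swap a c).prod = 1) : 2 ≤ w.count x := by
  by_contra! hlt
  obtain ⟨u, v, rfl⟩ := List.append_of_mem hx
  simp only [List.count_append, List.count_cons_self] at hlt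
  have hu : x ∉ u := List.count_eq_zero.mp (by omega)
  have hv : x ∉ v := List.count_eq_zero.mp (by omega)
  have h' := congrArg (fun σ : Perm α => σ x) h
  simp only [List.map_append, List.map_cons, List.prod_append, List.prod_cons, Perm.mul_apply,
    prod_map_swap_apply_of_notMem hxc hv, swap_apply_left, Perm.one_apply] at h'
  exact hxc ((Equiv.injective _) (h'.trans (prod_map_swap_apply_of_notMem hxc hu).symm)).symm

theorem mem_stackWords {c : α} {m : ℕ} {s : List α} {A : Finset α} {w : List α}
    (hs : ∀ x ∈ s, x ∉ A) (hnd : s.Nodup) (hsc : c ∉ s) (hAc : c ∉ A) :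
    w ∈ stackWords m s A ↔ w.length = m ∧ (∀ x ∈ w, x ∈ s ∨ x ∈ A) ∧
      (∀ x ∈ s ++ w, (s ++ w).count x = 2) ∧
      ((s.reverse ++ w).map fun a => swap a c).prod = 1 := by
  induction m generalizing s A w with
  | zero =>
    cases s with
    | nil =>
      simp only [stackWords, Finset.mem_singleton, List.length_eq_zero_iff]
      constructor
      · rintro rfl; simp
      · exact fun h => h.1
    | cons t s =>
      simp only [stackWords, Finset.notMem_empty, List.length_eq_zero_iff, false_iff]
      rintro ⟨rfl, -, h, -⟩
      have h1 := h t (by simp)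
      rw [List.append_nil, List.count_eq_one_of_mem hnd (by simp)] at h1
      omega
  | succ m ih =>
    cases w with
    | nil => cases s <;> simp [stackWords]
    | cons x w =>
    have push (hx : x ∈ A) : w ∈ stackWords m (x :: s) (A.erase x) ↔
        (x :: w).length = m + 1 ∧ (∀ y ∈ x :: w, y ∈ s ∨ y ∈ A) ∧
        (∀ y ∈ s ++ x :: w, (s ++ x :: w).count y = 2) ∧
        ((s.reverse ++ x :: w).map fun a => swap a c).prod = 1 := by
      have hxs : x ∉ s := fun h => hs x h hx
      have hperm : (x :: s ++ w).Perm (s ++ x :: w) := List.perm_middle.symm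
      rw [ih (by grind) (by simp [hxs, hnd]) (by grind) (by grind)]
      refine and_congr (by simp) (and_congr (by grind) (and_congr ?_ (by simp)))
      simp only [hperm.mem_iff, hperm.count_eq]
    have push_iff : (x :: w ∈ A.biUnion fun y =>
        (stackWords m (y :: s) (A.erase y)).image (List.cons y)) ↔
        x ∈ A ∧ w ∈ stackWords m (x :: s) (A.erase x) := by
      simp only [Finset.mem_biUnion, Finset.mem_image, List.cons.injEq]
      grind
    cases s with
    | nil =>
      rw [stackWords, push_iff]
      constructor
      · rintro ⟨hx, h⟩
        exact (push hx).1 h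
      · intro h
        have hx : x ∈ A := by simpa using h.2.1 x (by simp)
        exact ⟨hx, (push hx).2 h⟩
    | cons t s =>
      rw [stackWords, Finset.mem_union, push_iff]
      by_cases hx : x ∈ A
      · have hxt : t ≠ x := by rintro rfl; exact hs t (by simp) hx
        rw [← push hx]
        simp [hx, hxt]
      simp only [hx, false_and, or_false, Finset.mem_image, List.cons.injEq]
      have hts : t ∉ s := (List.nodup_cons.mp hnd).1
      have ihs := ih (s := s) (A := A) (w := w) (fun y hy => hs y (by simp [hy]))
        (List.nodup_cons.mp hnd).2 (by grind) hAc
      have hprod : (((t :: s).reverse ++ t :: w).map fun a => swap a c).prod =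
          ((s.reverse ++ w).map fun a => swap a c).prod := by
        simp [← mul_assoc]
      constructor
      · rintro ⟨w', hw, rfl, rfl⟩
        obtain ⟨h1, h2, h3, h4⟩ := ihs.1 hw
        have htw : t ∉ w' := by
          have := hs t (by simp)
          grind
        refine ⟨by simp [h1], by grind, ?_, hprod.trans h4⟩
        intro y hy
        by_cases hyt : y = t
        · subst hyt
          simp [List.count_append, List.count_eq_zero.mpr hts, List.count_eq_zero.mpr htw]
        · have := h3 y (by grind)
          simpa [List.count_append, List.count_cons, Ne.symm hyt] using this
      · rintro ⟨h1, h2, h3, h4⟩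
        have hxs : x ∈ t :: s := by
          have := h2 x (by simp)
          tauto
        have hc2 := h3 x (by simp)
        rw [List.count_append, List.count_eq_one_of_mem hnd hxs, List.count_cons_self] at hc2
        have hxw : x ∉ w := List.count_eq_zero.mp (by omega)
        obtain rfl : x = t := by
          by_contra hxt
          refine prod_map_swap_ne_one_of_stuck (c := c) (t := t) (x := x) (u := s.reverse)
            (v := w) (by grind) (by grind) hxt (by simpa using hts) hxw ?_
          simpa using h4
        refine ⟨w, ihs.2 ⟨by simpa using h1, by grind, ?_, hprod ▸ h4⟩, rfl, rfl⟩
        intro y hy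
        have hyt : x ≠ y := by rintro rfl; grind
        have := h3 y (by grind)
        simpa [List.count_append, List.count_cons, hyt] using this

theorem count_eq_two_iff_card_toFinset {c : α} {p : ℕ} {w : List α} (hlen : w.length = 2 * p)
    (hwc : ∀ x ∈ w, x ≠ c) (h : (w.map fun a => swap a c).prod = 1) :
    (∀ x ∈ w, w.count x = 2) ↔ w.toFinset.card = p := by
  have hsum : ∑ x ∈ w.toFinset, w.count x = 2 * p := by
    rw [List.sum_toFinset_count_eq_length, hlen]
  constructor
  · intro h2
    rw [Finset.sum_congr rfl fun x hx => h2 x (List.mem_toFinset.mp hx)] at hsum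
    simp at hsum
    omega
  · intro hp
    have hle : ∀ x ∈ w.toFinset, 2 ≤ w.count x := fun x hx =>
      have hx := List.mem_toFinset.mp hx
      two_le_count_of_prod_map_swap_eq_one (hwc x hx) hx h
    have heq := (Finset.sum_eq_sum_iff_of_le hle).mp (by simp [hsum, hp, mul_comm])
    exact fun x hx => (heq x (List.mem_toFinset.mpr hx)).symm

end StackWords

/-- The number of `2p`-tuples `(i_1, …, i_{2p})` of elements of `{1, …, n−1}` whose set of
values has cardinality exactly `p` and whose associated product of transpositions
`(i_1 n)(i_2 n)⋯(i_{2p} n)` is the identity permutation equals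
`(n−1)(n−2)⋯(n−p) · Cat(p)`. -/
theorem card_tuples_prod_eq_one (p n : ℕ) (hn : p + 1 ≤ n) :
    Nat.card {f : Fin (2 * p) → Fin n //
        (∀ l, f l ≠ ⟨n - 1, by omega⟩) ∧
        (Finset.univ.image f).card = p ∧
        (List.ofFn fun l => Equiv.swap (f l) (⟨n - 1, by omega⟩ : Fin n)).prod = 1} =
      (∏ i ∈ Finset.range p, (n - 1 - i)) * Cat p := by
  set c : Fin n := ⟨n - 1, by omega⟩
  have key : ∀ f : Fin (2 * p) → Fin n,
      ((∀ l, f l ≠ c) ∧ (Finset.univ.image f).card = p ∧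
        (List.ofFn fun l => Equiv.swap (f l) c).prod = 1) ↔
      List.ofFn f ∈ stackWords (2 * p) [] (Finset.univ.erase c) := by
    intro f
    rw [mem_stackWords (c := c) (by simp) (by simp) (by simp) (by simp)]
    have himage : Finset.univ.image f = (List.ofFn f).toFinset := by
      ext x
      simp [List.mem_ofFn]
    have hmap : (List.ofFn fun l => Equiv.swap (f l) c) =
        (List.ofFn f).map fun a => swap a c := by
      simp [List.map_ofFn, Function.comp_def]
    have hne : (∀ l, f l ≠ c) ↔ ∀ x ∈ List.ofFn f, x ≠ c := by
      simp [List.mem_ofFn]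
    rw [himage, hmap, hne]
    constructor
    · rintro ⟨h1, h2, h3⟩
      exact ⟨by simp, fun x hx => .inr (by simpa using h1 x hx),
        (count_eq_two_iff_card_toFinset (by simp) h1 h3).2 h2, h3⟩
    · rintro ⟨-, h1, h2, h3⟩
      have h1' : ∀ x ∈ List.ofFn f, x ≠ c := fun x hx => by simpa using h1 x hx
      exact ⟨h1', (count_eq_two_iff_card_toFinset (by simp) h1' h3).1 h2, h3⟩
  have himg : List.ofFn '' {f : Fin (2 * p) → Fin n | (∀ l, f l ≠ c) ∧
      (Finset.univ.image f).card = p ∧ (List.ofFn fun l => Equiv.swap (f l) c).prod = 1} =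
      (stackWords (2 * p) [] (Finset.univ.erase c) : Set (List (Fin n))) := by
    ext w
    constructor
    · rintro ⟨f, hf, rfl⟩
      exact (key f).1 hf
    · intro hw
      have hlen := ((mem_stackWords (c := c) (by simp) (by simp) (by simp) (by simp)).1 hw).1
      obtain ⟨f, rfl⟩ : ∃ f : Fin (2 * p) → Fin n, List.ofFn f = w := by
        rw [← hlen]
        exact ⟨w.get, List.ofFn_get w⟩
      exact ⟨f, (key f).2 hw, rfl⟩
  change Set.ncard {f : Fin (2 * p) → Fin n | _} = _
  rw [← Set.ncard_image_of_injective _ List.ofFn_injective, himg, Set.ncard_coe_finset,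
    card_stackWords (k := p) (by simp) (by simp), Finset.card_erase_of_mem (Finset.mem_univ c),
    Finset.card_univ, Fintype.card_fin, Nat.descFactorial_eq_prod_range, List.length_nil,
    ballot_zero_right]
end
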